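/- arXiv:2411.07431 — 10 statements merged into one kernel-verified Lean document; each statement's English description precedes it below -/
import Mathlib

section
/- Let X be a topological space and let D be a bounded-complete domain containing at least two elements, equipped with its Scott topology. Then the poset [X → D] of continuous maps from X to D, ordered pointwise, is a bounded-complete domain if and only if X is core-compact. -/
open Set TopologicalSpace

/-- The way-below relation: `x ≪ y` iff for every (nonempty) directed set `A`
whose supremum exists and satisfies `y ≤ ⊔ A`, some `d ∈ A` satisfies `x ≤ d`. -/
def WayBelow {α : Type*} [Preorder α] (x y : α) : Prop :=
  ∀ A : Set α, A.Nonempty → DirectedOn (· ≤ ·) A → ∀ a : α, IsLUB A a → y ≤ a → ∃ d ∈ A, x ≤ d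

/-- A bc-domain: a pointed, directed-complete, continuous, bounded-complete poset. -/
def IsBCDomain (D : Type*) [PartialOrder D] : Prop :=
  (∃ b : D, ∀ x : D, b ≤ x) ∧
  (∀ A : Set D, A.Nonempty → DirectedOn (· ≤ ·) A → ∃ a : D, IsLUB A a) ∧
  (∀ x : D, {a : D | WayBelow a x}.Nonempty ∧ DirectedOn (· ≤ ·) {a : D | WayBelow a x} ∧
    IsLUB {a : D | WayBelow a x} x) ∧
  (∀ A : Set D, BddAbove A → ∃ a : D, IsLUB A a)

/-- Scott-open subsets of a poset. -/
def IsScottOpen {D : Type*} [Preorder D] (O : Set D) : Prop :=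
  (∀ ⦃x⦄, x ∈ O → ∀ ⦃y⦄, x ≤ y → y ∈ O) ∧
  (∀ A : Set D, A.Nonempty → DirectedOn (· ≤ ·) A → ∀ a : D, IsLUB A a → a ∈ O →
    (A ∩ O).Nonempty)

/-- The Scott topology on a poset. -/
def scottTopology (D : Type*) [Preorder D] : TopologicalSpace D where
  IsOpen := IsScottOpen
  isOpen_univ := ⟨fun _ _ _ _ => trivial, fun A hA _ _ _ _ => by simpa using hA⟩
  isOpen_inter := by
    rintro O₁ O₂ ⟨hu₁, hd₁⟩ ⟨hu₂, hd₂⟩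
    refine ⟨fun x hx y hxy => ⟨hu₁ hx.1 hxy, hu₂ hx.2 hxy⟩, ?_⟩
    rintro A hA hdir a ha ⟨h1, h2⟩
    obtain ⟨x₁, hx₁A, hx₁⟩ := hd₁ A hA hdir a ha h1
    obtain ⟨x₂, hx₂A, hx₂⟩ := hd₂ A hA hdir a ha h2
    obtain ⟨z, hzA, hz₁, hz₂⟩ := hdir x₁ hx₁A x₂ hx₂A
    exact ⟨z, hzA, hu₁ hx₁ hz₁, hu₂ hx₂ hz₂⟩
  isOpen_sUnion := by
    intro 𝒮 h𝒮
    refine ⟨?_, ?_⟩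
    · rintro x ⟨O, hO, hxO⟩ y hxy
      exact ⟨O, hO, (h𝒮 O hO).1 hxO hxy⟩
    · rintro A hA hdir a ha ⟨O, hO, haO⟩
      obtain ⟨z, hzA, hzO⟩ := (h𝒮 O hO).2 A hA hdir a ha haO
      exact ⟨z, hzA, O, hO, hzO⟩

/-- The space `[X → D]` of continuous maps from a topological space `X` to a poset `D`
carrying its Scott topology, ordered pointwise (via the subtype order). -/
abbrev CMap (X : Type*) [TopologicalSpace X] (D : Type*) [Preorder D] : Type _ :=
  {f : X → D // @Continuous X D _ (scottTopology D) f}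

/-- The set `{ ⊓ f(ι⁻¹(U)) : y ∈ U, U open in Y }` of infima used to define `f_*`. -/
def starSet {X Y D : Type*} [TopologicalSpace Y] [Preorder D]
    (ι : X → Y) (f : X → D) (y : Y) : Set D :=
  {d : D | ∃ U : Set Y, IsOpen U ∧ y ∈ U ∧ IsGLB (f '' (ι ⁻¹' U)) d}

/-- A complete lattice is continuous if every element is the directed supremum of the
elements way-below it. -/
def IsContinuousLattice (L : Type*) [CompleteLattice L] : Prop :=
  ∀ x : L, {a : L | WayBelow a x}.Nonempty ∧ DirectedOn (· ≤ ·) {a : L | WayBelow a x} ∧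
    IsLUB {a : L | WayBelow a x} x

/-- A complete lattice is algebraic if every element is the directed supremum of the
finite (compact) elements below it. -/
def IsAlgebraicLattice (L : Type*) [CompleteLattice L] : Prop :=
  ∀ x : L, {a : L | WayBelow a a ∧ a ≤ x}.Nonempty ∧
    DirectedOn (· ≤ ·) {a : L | WayBelow a a ∧ a ≤ x} ∧
    IsLUB {a : L | WayBelow a a ∧ a ≤ x} x

/-- `B` is a (domain-theoretic) basis for the poset `D`: for every `x`, the set of
elements of `B` way-below `x` is directed with supremum `x`. -/
def IsBasisFor {D : Type*} [Preorder D] (B : Set D) : Prop :=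
  ∀ x : D, {b : D | b ∈ B ∧ WayBelow b x}.Nonempty ∧
    DirectedOn (· ≤ ·) {b : D | b ∈ B ∧ WayBelow b x} ∧
    IsLUB {b : D | b ∈ B ∧ WayBelow b x} x

/-- A space is strongly locally compact if its topology has a base of compact-open sets. -/
def StronglyLocallyCompact (Y : Type*) [TopologicalSpace Y] : Prop :=
  ∀ U : Set Y, IsOpen U → ∀ x ∈ U, ∃ Q : Set Y, IsCompact Q ∧ IsOpen Q ∧ x ∈ Q ∧ Q ⊆ U

open Classical in
/-- The single-step function `b·χ_O`. -/
noncomputable def stepFn {Y D : Type*} [Preorder D] [OrderBot D] (b : D) (O : Set Y) : Y → D :=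
  fun y => if y ∈ O then b else ⊥

theorem WayBelow.le' {D : Type*} [PartialOrder D] {x y : D} (h : WayBelow x y) : x ≤ y := by
  obtain ⟨d, hd, hx⟩ := h {y} ⟨y, rfl⟩ (by
    rintro a rfl b rfl
    exact ⟨_, rfl, le_rfl, le_rfl⟩) y isLUB_singleton le_rfl
  rw [mem_singleton_iff] at hd
  exact hd ▸ hx

theorem WayBelow.mono' {D : Type*} [PartialOrder D] {x x' y y' : D} (h : WayBelow x y)
    (hx : x' ≤ x) (hy : y ≤ y') : WayBelow x' y' := by
  intro A hA hd a ha hya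
  obtain ⟨d, hd, hxd⟩ := h A hA hd a ha (hy.trans hya)
  exact ⟨d, hd, hx.trans hxd⟩

theorem wayBelow_interp {D : Type*} [PartialOrder D] (hD : IsBCDomain D) {x y : D}
    (h : WayBelow x y) : ∃ z, WayBelow x z ∧ WayBelow z y := by
  obtain ⟨-, -, hc, -⟩ := hD
  obtain ⟨d, ⟨b, hdb, hby⟩, hxd⟩ := h {a | ∃ b, WayBelow a b ∧ WayBelow b y}
    (by
      obtain ⟨b, hb⟩ := (hc y).1
      obtain ⟨a, ha⟩ := (hc b).1
      exact ⟨a, b, ha, hb⟩)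
    (by
      rintro a₁ ⟨b₁, h₁, h₁'⟩ a₂ ⟨b₂, h₂, h₂'⟩
      obtain ⟨b, hb, hb₁, hb₂⟩ := (hc y).2.1 b₁ h₁' b₂ h₂'
      obtain ⟨a, ha, ha₁, ha₂⟩ := (hc b).2.1 a₁ (h₁.mono' le_rfl hb₁) a₂ (h₂.mono' le_rfl hb₂)
      exact ⟨a, ⟨b, ha, hb⟩, ha₁, ha₂⟩)
    y
    (by
      constructor
      · rintro a ⟨b, hab, hby⟩
        exact hab.le'.trans hby.le'
      · intro u hu
        refine (hc y).2.2.2 fun b hb => (hc b).2.2.2 fun a ha => hu ⟨b, ha, hb⟩)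
    le_rfl
  exact ⟨b, hdb.mono' hxd le_rfl, hby⟩

theorem isScottOpen_wayAbove {D : Type*} [PartialOrder D] (hD : IsBCDomain D) (e : D) :
    IsScottOpen {y | WayBelow e y} := by
  refine ⟨fun x hx y hxy => WayBelow.mono' hx le_rfl hxy, ?_⟩
  intro A hA hd a ha hea
  obtain ⟨z, hez, hza⟩ := wayBelow_interp hD hea
  obtain ⟨d, hdA, hzd⟩ := hza A hA hd a ha le_rfl
  exact ⟨d, hdA, hez.mono' le_rfl hzd⟩

theorem cont_iff {X D : Type*} [TopologicalSpace X] [PartialOrder D] {f : X → D} :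
    @Continuous X D _ (scottTopology D) f ↔ ∀ O : Set D, IsScottOpen O → IsOpen (f ⁻¹' O) :=
  @continuous_def X D _ (scottTopology D) f

theorem cont_of_lub {X D : Type*} [TopologicalSpace X] [PartialOrder D] (hD : IsBCDomain D)
    (F : Set (CMap X D)) (g : X → D)
    (hg : ∀ x, IsLUB ((fun f : CMap X D => f.1 x) '' F) (g x)) :
    @Continuous X D _ (scottTopology D) g := by
  rw [cont_iff]
  intro O hO
  rw [isOpen_iff_forall_mem_open]
  intro x hx
  obtain ⟨⟨bot, hbot⟩, -, hc, hb⟩ := id hD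
  obtain ⟨d, ⟨U, hU, hxU, hdU⟩, hdO⟩ := hO.2 {d | ∃ U : Set X, IsOpen U ∧ x ∈ U ∧ ∀ y ∈ U, d ≤ g y}
    ⟨bot, univ, isOpen_univ, trivial, fun y _ => hbot _⟩
    (by
      rintro d₁ ⟨U, hU, hxU, h₁⟩ d₂ ⟨V, hV, hxV, h₂⟩
      have hub : ∀ y ∈ U ∩ V, g y ∈ upperBounds {d₁, d₂} := by
        rintro y ⟨hyU, hyV⟩ z (rfl | rfl)
        exacts [h₁ y hyU, h₂ y hyV]
      obtain ⟨s, hs⟩ := hb {d₁, d₂} ⟨g x, hub x ⟨hxU, hxV⟩⟩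
      exact ⟨s, ⟨U ∩ V, hU.inter hV, ⟨hxU, hxV⟩, fun y hy => hs.2 (hub y hy)⟩,
        hs.1 (by simp), hs.1 (by simp)⟩)
    (g x)
    (by
      constructor
      · rintro d ⟨U, -, hxU, h⟩
        exact h x hxU
      · intro u hu
        refine (hg x).2 ?_
        rintro _ ⟨f, hf, rfl⟩
        refine (hc (f.1 x)).2.2.2 fun e he => hu ?_
        refine ⟨f.1 ⁻¹' {y | WayBelow e y}, cont_iff.1 f.2 _ (isScottOpen_wayAbove hD e), he, ?_⟩
        intro y hy
        exact (WayBelow.le' hy).trans ((hg y).1 ⟨f, hf, rfl⟩))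
    hx
  exact ⟨U, fun y hy => hO.1 hdO (hdU y hy), hU, hxU⟩

theorem cmap_exists_lub {X D : Type*} [TopologicalSpace X] [PartialOrder D] (hD : IsBCDomain D)
    (F : Set (CMap X D))
    (hF : ∀ x, ∃ d, IsLUB ((fun f : CMap X D => f.1 x) '' F) d) :
    ∃ g : CMap X D, IsLUB F g ∧ ∀ x, IsLUB ((fun f : CMap X D => f.1 x) '' F) (g.1 x) := by
  choose g hg using hF
  refine ⟨⟨g, cont_of_lub hD F g hg⟩, ⟨?_, ?_⟩, hg⟩
  · intro f hf x
    exact (hg x).1 ⟨f, hf, rfl⟩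
  · intro u hu x
    refine (hg x).2 ?_
    rintro _ ⟨f, hf, rfl⟩
    exact hu hf x

theorem cmap_directed_lub {X D : Type*} [TopologicalSpace X] [PartialOrder D] (hD : IsBCDomain D)
    (F : Set (CMap X D)) (hne : F.Nonempty) (hdir : DirectedOn (· ≤ ·) F) :
    ∃ g : CMap X D, IsLUB F g ∧ ∀ x, IsLUB ((fun f : CMap X D => f.1 x) '' F) (g.1 x) := by
  refine cmap_exists_lub hD F fun x => hD.2.1 _ (hne.image _) ?_
  rintro _ ⟨f₁, h₁, rfl⟩ _ ⟨f₂, h₂, rfl⟩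
  obtain ⟨f, hf, hf₁, hf₂⟩ := hdir f₁ h₁ f₂ h₂
  exact ⟨f.1 x, ⟨f, hf, rfl⟩, hf₁ x, hf₂ x⟩

theorem cmap_lub_apply {X D : Type*} [TopologicalSpace X] [PartialOrder D] (hD : IsBCDomain D)
    {F : Set (CMap X D)} (hne : F.Nonempty) (hdir : DirectedOn (· ≤ ·) F) {a : CMap X D}
    (ha : IsLUB F a) (x : X) : IsLUB ((fun f : CMap X D => f.1 x) '' F) (a.1 x) := by
  obtain ⟨g, hg, h⟩ := cmap_directed_lub hD F hne hdir
  rw [ha.unique hg]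
  exact h x

/-- If bounded pairs have sups, the way-below set is directed. -/
theorem wayBelow_directed {D : Type*} [PartialOrder D]
    (hb : ∀ A : Set D, BddAbove A → ∃ a : D, IsLUB A a) (x : D) :
    DirectedOn (· ≤ ·) {a : D | WayBelow a x} := by
  intro a ha b hb'
  obtain ⟨s, hs⟩ := hb {a, b} ⟨x, by
    rintro z (rfl | rfl)
    exacts [WayBelow.le' ha, WayBelow.le' hb']⟩
  refine ⟨s, ?_, hs.1 (by simp), hs.1 (by simp)⟩
  intro A hA hd c hc hxc
  obtain ⟨d₁, h₁, h₁'⟩ := ha A hA hd c hc hxc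
  obtain ⟨d₂, h₂, h₂'⟩ := hb' A hA hd c hc hxc
  obtain ⟨d, hdA, hd₁, hd₂⟩ := hd d₁ h₁ d₂ h₂
  refine ⟨d, hdA, hs.2 ?_⟩
  rintro z (rfl | rfl)
  exacts [h₁'.trans hd₁, h₂'.trans hd₂]

theorem wayBelow_bot {D : Type*} [PartialOrder D] {b : D} (h : ∀ x, b ≤ x) (x : D) :
    WayBelow b x := by
  rintro A ⟨a, ha⟩ - - - -
  exact ⟨a, ha, h a⟩

open Classical in
theorem cont_step {X D : Type*} [TopologicalSpace X] [PartialOrder D] {b : D}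
    (h : ∀ x, b ≤ x) (d : D) (U : Opens X) :
    @Continuous X D _ (scottTopology D) (fun x => if x ∈ U then d else b) := by
  rw [cont_iff]
  intro O hO
  by_cases hbO : b ∈ O
  · convert isOpen_univ
    ext x
    simp only [mem_preimage, mem_univ, iff_true]
    exact hO.1 hbO (h _)
  by_cases hdO : d ∈ O
  · convert U.2
    ext x
    by_cases hx : x ∈ U <;> simp [hx, hbO, hdO]
  · convert isOpen_empty
    ext x
    by_cases hx : x ∈ U <;> simp [hx, hbO, hdO]

open Classical in
noncomputable def cstep {X D : Type*} [TopologicalSpace X] [PartialOrder D] {b : D}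
    (h : ∀ x, b ≤ x) (d : D) (U : Opens X) : CMap X D :=
  ⟨fun x => if x ∈ U then d else b, cont_step h d U⟩

theorem cstep_mem {X D : Type*} [TopologicalSpace X] [PartialOrder D] {b : D}
    (h : ∀ x, b ≤ x) (d : D) {U : Opens X} {x : X} (hx : x ∈ U) : (cstep h d U).1 x = d := by
  simp [cstep, hx]

theorem cstep_notMem {X D : Type*} [TopologicalSpace X] [PartialOrder D] {b : D}
    (h : ∀ x, b ≤ x) (d : D) {U : Opens X} {x : X} (hx : x ∉ U) : (cstep h d U).1 x = b := by
  simp [cstep, hx]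

theorem cstep_le {X D : Type*} [TopologicalSpace X] [PartialOrder D] {b : D}
    (h : ∀ x, b ≤ x) (d : D) {U : Opens X} {f : CMap X D} (hf : ∀ x ∈ U, d ≤ f.1 x) :
    cstep h d U ≤ f := by
  intro x
  by_cases hx : x ∈ U
  · exact (cstep_mem h d hx).le.trans (hf x hx)
  · exact (cstep_notMem h d hx).le.trans (h _)

theorem opens_lub_mem {X : Type*} [TopologicalSpace X] {A : Set (Opens X)} {a : Opens X}
    (ha : IsLUB A a) {x : X} : x ∈ a ↔ ∃ U ∈ A, x ∈ U := by
  rw [ha.unique (isLUB_sSup A), Opens.mem_sSup]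

theorem bc_of_coreCompact {X D : Type*} [TopologicalSpace X] [PartialOrder D]
    (hD : IsBCDomain D) (hX : IsContinuousLattice (Opens X)) : IsBCDomain (CMap X D) := by
  obtain ⟨⟨bot, hbot⟩, -, hc, hb⟩ := id hD
  have hbot' : ∀ f : CMap X D, cstep hbot bot ⊥ ≤ f := fun f => cstep_le _ _ fun x _ => hbot _
  have hbd : ∀ A : Set (CMap X D), BddAbove A → ∃ a, IsLUB A a := by
    rintro A ⟨u, hu⟩
    obtain ⟨g, hg, -⟩ := cmap_exists_lub hD A fun x => hb _ ⟨u.1 x, by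
      rintro _ ⟨f, hf, rfl⟩
      exact hu hf x⟩
    exact ⟨g, hg⟩
  refine ⟨⟨_, hbot'⟩, ?_, ?_, hbd⟩
  · intro A hA hd
    obtain ⟨g, hg, -⟩ := cmap_directed_lub hD A hA hd
    exact ⟨g, hg⟩
  intro f
  refine ⟨⟨_, wayBelow_bot hbot' f⟩, wayBelow_directed hbd f, fun g hg => WayBelow.le' hg, ?_⟩
  intro u hu x
  refine (hc (f.1 x)).2.2.2 fun e he => ?_
  let pre : CMap X D → Opens X := fun g =>
    ⟨g.1 ⁻¹' {y | WayBelow e y}, cont_iff.1 g.2 _ (isScottOpen_wayAbove hD e)⟩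
  have hxV : x ∈ pre f := he
  obtain ⟨W, hW, hxW⟩ := (opens_lub_mem (hX (pre f)).2.2).1 hxV
  have key : WayBelow (cstep hbot e W) f := by
    intro A hA hd a ha hfa
    have hlub : IsLUB (pre '' A) (sSup (pre '' A)) := isLUB_sSup _
    obtain ⟨_, ⟨g, hg, rfl⟩, hWg⟩ := hW (pre '' A) (hA.image _)
      (by
        rintro _ ⟨g₁, h₁, rfl⟩ _ ⟨g₂, h₂, rfl⟩
        obtain ⟨g, hg, hg₁, hg₂⟩ := hd g₁ h₁ g₂ h₂
        exact ⟨pre g, ⟨g, hg, rfl⟩, fun y hy => WayBelow.mono' hy le_rfl (hg₁ y),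
          fun y hy => WayBelow.mono' hy le_rfl (hg₂ y)⟩)
      _ hlub
      (by
        intro y hy
        have hy' : WayBelow e (a.1 y) := WayBelow.mono' hy le_rfl (hfa y)
        obtain ⟨_, ⟨g, hg, rfl⟩, hgy⟩ := (isScottOpen_wayAbove hD e).2
          ((fun f : CMap X D => f.1 y) '' A) (hA.image _)
          (by
            rintro _ ⟨g₁, h₁, rfl⟩ _ ⟨g₂, h₂, rfl⟩
            obtain ⟨g, hg, hg₁, hg₂⟩ := hd g₁ h₁ g₂ h₂
            exact ⟨_, ⟨g, hg, rfl⟩, hg₁ y, hg₂ y⟩)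
          _ (cmap_lub_apply hD hA hd ha y) hy'
        exact (opens_lub_mem hlub).2 ⟨_, ⟨g, hg, rfl⟩, hgy⟩)
    exact ⟨g, hg, cstep_le _ _ fun y hy => WayBelow.le' (hWg hy)⟩
  exact (cstep_mem hbot e hxW).ge.trans (hu key x)

theorem coreCompact_of_bc {X D : Type*} [TopologicalSpace X] [PartialOrder D]
    (hD : IsBCDomain D) (hD2 : ∃ a b : D, a ≠ b) (hC : IsBCDomain (CMap X D)) :
    IsContinuousLattice (Opens X) := by
  obtain ⟨bot, hbot⟩ := id hD.1
  obtain ⟨d, hd⟩ : ∃ d : D, d ≠ bot := by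
    by_contra! h
    obtain ⟨a, b, hab⟩ := hD2
    exact hab ((h a).trans (h b).symm)
  have hO : IsScottOpen {y : D | y ≠ bot} := by
    refine ⟨fun x hx y hxy hy => hx (le_antisymm (hxy.trans hy.le) (hbot _)), ?_⟩
    intro A _ _ a ha hab
    by_contra hne
    refine hab (le_antisymm (ha.2 fun z hz => ?_) (hbot _))
    by_contra hz'
    exact hne ⟨z, hz, fun h => hz' h.le⟩
  intro U
  refine ⟨⟨⊥, wayBelow_bot (fun _ => bot_le) U⟩,
    wayBelow_directed (fun A _ => ⟨_, isLUB_sSup A⟩) U, fun g hg => WayBelow.le' hg, ?_⟩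
  intro V hV x hxU
  obtain ⟨hne, hdir, hlub⟩ := hC.2.2.1 (cstep hbot d U)
  have hx := cmap_lub_apply hD hne hdir hlub x
  rw [cstep_mem hbot d hxU] at hx
  obtain ⟨g, hg, hgx⟩ : ∃ g : CMap X D, WayBelow g (cstep hbot d U) ∧ g.1 x ≠ bot := by
    by_contra! h
    refine hd (le_antisymm (hx.2 ?_) (hbot _))
    rintro _ ⟨g, hg, rfl⟩
    exact (h g hg).le
  let W : Opens X := ⟨g.1 ⁻¹' {y | y ≠ bot}, cont_iff.1 g.2 _ hO⟩
  have hW : WayBelow W U := by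
    intro A hA hAd a ha hUa
    obtain ⟨_, ⟨S, hS, rfl⟩, hgS⟩ := hg (cstep hbot d '' A) (hA.image _)
      (by
        rintro _ ⟨S₁, h₁, rfl⟩ _ ⟨S₂, h₂, rfl⟩
        obtain ⟨S, hS, hS₁, hS₂⟩ := hAd S₁ h₁ S₂ h₂
        exact ⟨_, ⟨S, hS, rfl⟩, cstep_le _ _ fun y hy => (cstep_mem hbot d (hS₁ hy)).ge,
          cstep_le _ _ fun y hy => (cstep_mem hbot d (hS₂ hy)).ge⟩)
      (cstep hbot d a)
      (by
        constructor
        · rintro _ ⟨S, hS, rfl⟩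
          exact cstep_le _ _ fun y hy => (cstep_mem hbot d (ha.1 hS hy)).ge
        · intro u hu
          refine cstep_le _ _ fun y hy => ?_
          obtain ⟨S, hS, hyS⟩ := (opens_lub_mem ha).1 hy
          exact (cstep_mem hbot d hyS).ge.trans (hu ⟨S, hS, rfl⟩ y))
      (cstep_le _ _ fun y hy => (cstep_mem hbot d (hUa hy)).ge)
    refine ⟨S, hS, fun y hy => ?_⟩
    by_contra hyS
    exact hy (le_antisymm ((hgS y).trans (cstep_notMem hbot d hyS).le) (hbot _))
  exact hV hW hgx

/-- For a topological space `X` and a bounded-complete domain `D` with at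
least two elements (with its Scott topology), the poset `[X → D]` of continuous maps,
ordered pointwise, is a bc-domain iff `X` is core-compact. -/
theorem bcDomain_functionSpace_iff_coreCompact
    {X D : Type*} [TopologicalSpace X] [PartialOrder D]
    (hD : IsBCDomain D) (hD2 : ∃ a b : D, a ≠ b) :
    IsBCDomain (CMap X D) ↔ IsContinuousLattice (TopologicalSpace.Opens X) := 
  ⟨coreCompact_of_bc hD hD2, bc_of_coreCompact hD⟩
end

section
/- A topological space Y is strongly locally compact (i.e., its topology has a base consisting of compact-open subsets) if and only if the complete lattice (τ_Y, ⊆) of open sets of Y is an algebraic lattice. -/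
open Set TopologicalSpace

theorem wayBelow_self_iff_isCompact {Y : Type*} [TopologicalSpace Y] (U : Opens Y) :
    WayBelow U U ↔ IsCompact (U : Set Y) := by
  rw [← Opens.isCompactElement_iff]
  constructor
  · intro h s a hs hd ha hU
    exact h s hs hd a ha hU
  · intro h A hA hd a ha hU
    exact h A a hA hd ha hU

/-- A topological space `Y` is strongly locally compact iff the complete
lattice of open sets of `Y` is an algebraic lattice. -/
theorem stronglyLocallyCompact_iff_algebraic {Y : Type*} [TopologicalSpace Y] :
    StronglyLocallyCompact Y ↔ IsAlgebraicLattice (TopologicalSpace.Opens Y) := by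
  constructor
  · intro h U
    have hbot : WayBelow (⊥ : Opens Y) ⊥ := by
      rw [wayBelow_self_iff_isCompact]; simp
    refine ⟨⟨⊥, hbot, bot_le⟩, ?_, ?_⟩
    · rintro a ⟨ha, haU⟩ b ⟨hb, hbU⟩
      refine ⟨a ⊔ b, ⟨?_, sup_le haU hbU⟩, le_sup_left, le_sup_right⟩
      rw [wayBelow_self_iff_isCompact] at *
      rw [Opens.coe_sup]
      exact ha.union hb
    · refine ⟨fun a ha => ha.2, fun V hV x hx => ?_⟩
      obtain ⟨Q, hQc, hQo, hxQ, hQU⟩ := h U U.isOpen x hx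
      have hle : (⟨Q, hQo⟩ : Opens Y) ≤ V :=
        hV ⟨(wayBelow_self_iff_isCompact _).2 hQc, hQU⟩
      exact hle hxQ
  · intro h U hU x hx
    have hl := (h ⟨U, hU⟩).2.2
    have hx' : x ∈ sSup {a : Opens Y | WayBelow a a ∧ a ≤ ⟨U, hU⟩} := by
      rw [hl.sSup_eq]; exact hx
    obtain ⟨Q, ⟨hQ, hQU⟩, hxQ⟩ := Opens.mem_sSup.1 hx'
    exact ⟨Q, (wayBelow_self_iff_isCompact Q).1 hQ, Q.isOpen, hxQ, hQU⟩
end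

section
/- Let ι : X → Y be a dense quasi-embedding of topological spaces and D a bc-domain with its Scott topology. For every continuous f ∈ [X → D], the assignment f_*(y) = ⊔{ ⊓ f(ι⁻¹(U)) : y ∈ U, U open in Y } is well-defined (each set f(ι⁻¹(U)) is nonempty so its infimum exists, and the indexed set of infima is directed), and the resulting map f_* : Y → D is continuous with respect to the topology of Y and the Scott topology on D, i.e., f_* ∈ [Y → D]. -/
open Set TopologicalSpace

/-- For a dense quasi-embedding `ι : X → Y` and a bc-domain `D`, for every
continuous `f : X → D` the assignment `f_*(y) = ⊔{ ⊓ f(ι⁻¹(U)) : y ∈ U open }` is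
well-defined (each `f(ι⁻¹ U)` is nonempty and has an infimum, and the indexed set of
infima is directed with a supremum), and any resulting map `f_* : Y → D` is continuous
for the Scott topology on `D`. -/
theorem fstar_wellDefined_and_continuous
    {X Y D : Type*} [TopologicalSpace X] [TopologicalSpace Y] [PartialOrder D]
    (hD : IsBCDomain D)
    (ι : X → Y) (hcont : Continuous ι)
    (hro : ∀ U : Set X, IsOpen U → ∃ V : Set Y, IsOpen V ∧ U = ι ⁻¹' V)
    (hdense : Dense (Set.range ι))
    (f : X → D) (hf : @Continuous X D _ (scottTopology D) f) :
    (∀ U : Set Y, IsOpen U → U.Nonempty →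
      (f '' (ι ⁻¹' U)).Nonempty ∧ ∃ d : D, IsGLB (f '' (ι ⁻¹' U)) d) ∧
    (∀ y : Y, (starSet ι f y).Nonempty ∧ DirectedOn (· ≤ ·) (starSet ι f y) ∧
      ∃ a : D, IsLUB (starSet ι f y) a) ∧
    (∀ g : Y → D, (∀ y : Y, IsLUB (starSet ι f y) (g y)) →
      @Continuous Y D _ (scottTopology D) g) := by
  have h1 : ∀ U : Set Y, IsOpen U → U.Nonempty →
      (f '' (ι ⁻¹' U)).Nonempty ∧ ∃ d : D, IsGLB (f '' (ι ⁻¹' U)) d := by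
    intro U hU hne
    obtain ⟨_, hyU, x, rfl⟩ := hdense.inter_open_nonempty U hU hne
    have hn : (f '' (ι ⁻¹' U)).Nonempty := ⟨f x, x, hyU, rfl⟩
    refine ⟨hn, ?_⟩
    obtain ⟨d, hd⟩ := hD.2.2.2 (lowerBounds (f '' (ι ⁻¹' U)))
      ⟨f x, fun a ha => ha ⟨x, hyU, rfl⟩⟩
    exact ⟨d, isLUB_lowerBounds.mp hd⟩
  have h2 : ∀ y : Y, (starSet ι f y).Nonempty ∧ DirectedOn (· ≤ ·) (starSet ι f y) := by
    intro y
    constructor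
    · obtain ⟨_, d, hd⟩ := h1 Set.univ isOpen_univ ⟨y, trivial⟩
      exact ⟨d, Set.univ, isOpen_univ, trivial, hd⟩
    · rintro a ⟨U, hU, hyU, ha⟩ b ⟨V, hV, hyV, hb⟩
      obtain ⟨_, d, hd⟩ := h1 (U ∩ V) (hU.inter hV) ⟨y, hyU, hyV⟩
      refine ⟨d, ⟨U ∩ V, hU.inter hV, ⟨hyU, hyV⟩, hd⟩, hd.2 ?_, hd.2 ?_⟩
      · rintro _ ⟨x, hx, rfl⟩
        exact ha.1 ⟨x, hx.1, rfl⟩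
      · rintro _ ⟨x, hx, rfl⟩
        exact hb.1 ⟨x, hx.2, rfl⟩
  refine ⟨h1, fun y => ⟨(h2 y).1, (h2 y).2, hD.2.1 _ (h2 y).1 (h2 y).2⟩, ?_⟩
  intro g hg
  letI := scottTopology D
  refine continuous_def.mpr fun O hO => isOpen_iff_forall_mem_open.mpr fun y hy => ?_
  have hO' : IsScottOpen O := hO
  obtain ⟨d, ⟨U, hU, hyU, hd⟩, hdO⟩ := hO'.2 _ (h2 y).1 (h2 y).2 _ (hg y) hy
  exact ⟨U, fun z hz => hO'.1 hdO ((hg z).1 ⟨U, hU, hz, hd⟩), hU, hyU⟩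
end

section
/- Let ι : X → Y be a dense quasi-embedding of topological spaces and D a bc-domain with its Scott topology. The maps (·)_* : [X → D] → [Y → D] and (·)^* : [Y → D] → [X → D] are both monotone with respect to the pointwise orders, and they form a monotone section-retraction pair: (f_*)^* = f for every f ∈ [X → D]. Consequently (·)^* is surjective and (·)_* is injective. -/
open Set TopologicalSpace

theorem aux_glb {D : Type*} [PartialOrder D] (hD : IsBCDomain D) (S : Set D)
    (hS : S.Nonempty) : ∃ d, IsGLB S d := by
  obtain ⟨s, hs⟩ := hS
  obtain ⟨d, hd⟩ := hD.2.2.2 (lowerBounds S) ⟨s, fun a ha => ha hs⟩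
  exact ⟨d, isLUB_lowerBounds.1 hd⟩

theorem aux_le_wb {D : Type*} [PartialOrder D] {a b c : D} (h : WayBelow b c) (hab : a ≤ b) :
    WayBelow a c := by
  intro A hA hdir s hs hc
  obtain ⟨d, hd, hbd⟩ := h A hA hdir s hs hc
  exact ⟨d, hd, hab.trans hbd⟩

theorem aux_wb_le {D : Type*} [PartialOrder D] {a b c : D} (h : WayBelow a b) (hbc : b ≤ c) :
    WayBelow a c :=
  fun A hA hdir s hs hc => h A hA hdir s hs (hbc.trans hc)

theorem aux_scott {D : Type*} [PartialOrder D] (hD : IsBCDomain D) (a : D) :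
    IsScottOpen {z : D | WayBelow a z} := by
  refine ⟨fun x hx y hxy => aux_wb_le hx hxy, ?_⟩
  intro A hA hdir s hs ha
  have hc := hD.2.2.1
  obtain ⟨e, ⟨b, hb, heb⟩, hae⟩ := ha {e | ∃ b ∈ A, WayBelow e b} (by
      obtain ⟨b, hb⟩ := hA
      obtain ⟨e, he⟩ := (hc b).1
      exact ⟨e, b, hb, he⟩) (by
      rintro e₁ ⟨b₁, hb₁, h₁⟩ e₂ ⟨b₂, hb₂, h₂⟩
      obtain ⟨b, hb, h1, h2⟩ := hdir b₁ hb₁ b₂ hb₂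
      obtain ⟨e, he, h3, h4⟩ := (hc b).2.1 e₁ (aux_wb_le h₁ h1) e₂ (aux_wb_le h₂ h2)
      exact ⟨e, ⟨b, hb, he⟩, h3, h4⟩) s (by
      constructor
      · rintro e ⟨b, hb, he⟩
        exact ((hc b).2.2.1 he).trans (hs.1 hb)
      · intro u hu
        refine hs.2 fun b hb => (hc b).2.2.2 fun e he => hu ⟨b, hb, he⟩) le_rfl
  exact ⟨b, hb, aux_le_wb heb hae⟩

theorem aux_star {X Y D : Type*} [TopologicalSpace Y] [PartialOrder D]
    (hD : IsBCDomain D) (ι : X → Y) (hdense : Dense (Set.range ι)) (f : X → D)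
    (U : Set Y) (hU : IsOpen U) (y : Y) (hy : y ∈ U) : ∃ d, IsGLB (f '' (ι ⁻¹' U)) d := by
  apply aux_glb hD
  obtain ⟨_, hz, x, rfl⟩ := hdense.inter_open_nonempty U hU ⟨y, hy⟩
  exact ⟨f x, x, hz, rfl⟩

theorem aux_dir {X Y D : Type*} [TopologicalSpace Y] [PartialOrder D]
    (hD : IsBCDomain D) (ι : X → Y) (hdense : Dense (Set.range ι)) (f : X → D) (y : Y) :
    (starSet ι f y).Nonempty ∧ DirectedOn (· ≤ ·) (starSet ι f y) := by
  constructor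
  · obtain ⟨d, hd⟩ := aux_star hD ι hdense f univ isOpen_univ y trivial
    exact ⟨d, univ, isOpen_univ, trivial, hd⟩
  · rintro d₁ ⟨U, hU, hyU, h₁⟩ d₂ ⟨V, hV, hyV, h₂⟩
    obtain ⟨d, hd⟩ := aux_star hD ι hdense f (U ∩ V) (hU.inter hV) y ⟨hyU, hyV⟩
    refine ⟨d, ⟨U ∩ V, hU.inter hV, ⟨hyU, hyV⟩, hd⟩, ?_, ?_⟩
    · exact hd.2 (by rintro _ ⟨x, hx, rfl⟩; exact h₁.1 ⟨x, hx.1, rfl⟩)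
    · exact hd.2 (by rintro _ ⟨x, hx, rfl⟩; exact h₂.1 ⟨x, hx.2, rfl⟩)

/-- For a dense quasi-embedding `ι : X → Y` and a bc-domain `D`, the maps
`(·)^* : g ↦ g ∘ ι` and `(·)_*` (characterized by `f_*(y) = ⊔ starSet ι f y`) are both
monotone and form a monotone section-retraction pair `(f_*)^* = f`; consequently `(·)^*`
is surjective and `(·)_*` is injective. -/
theorem star_section_retraction
    {X Y D : Type*} [TopologicalSpace X] [TopologicalSpace Y] [PartialOrder D]
    (hD : IsBCDomain D)
    (ι : X → Y) (hcont : Continuous ι)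
    (hro : ∀ U : Set X, IsOpen U → ∃ V : Set Y, IsOpen V ∧ U = ι ⁻¹' V)
    (hdense : Dense (Set.range ι)) :
    (∀ g g' : Y → D, @Continuous Y D _ (scottTopology D) g →
      @Continuous Y D _ (scottTopology D) g' →
      (∀ y : Y, g y ≤ g' y) → ∀ x : X, g (ι x) ≤ g' (ι x)) ∧
    (∀ f f' : X → D, ∀ g g' : Y → D,
      @Continuous X D _ (scottTopology D) f → @Continuous X D _ (scottTopology D) f' →
      (∀ y : Y, IsLUB (starSet ι f y) (g y)) → (∀ y : Y, IsLUB (starSet ι f' y) (g' y)) →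
      (∀ x : X, f x ≤ f' x) → ∀ y : Y, g y ≤ g' y) ∧
    (∀ f : X → D, ∀ g : Y → D, @Continuous X D _ (scottTopology D) f →
      (∀ y : Y, IsLUB (starSet ι f y) (g y)) → ∀ x : X, g (ι x) = f x) ∧
    (∀ f : X → D, @Continuous X D _ (scottTopology D) f →
      ∃ g : Y → D, @Continuous Y D _ (scottTopology D) g ∧ ∀ x : X, g (ι x) = f x) ∧
    (∀ f f' : X → D, ∀ g : Y → D,
      @Continuous X D _ (scottTopology D) f → @Continuous X D _ (scottTopology D) f' →
      (∀ y : Y, IsLUB (starSet ι f y) (g y)) → (∀ y : Y, IsLUB (starSet ι f' y) (g y)) →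
      f = f') := by
  have key : ∀ f : X → D, ∀ g : Y → D, @Continuous X D _ (scottTopology D) f →
      (∀ y : Y, IsLUB (starSet ι f y) (g y)) → ∀ x : X, g (ι x) = f x := by
    intro f g hf hg x
    apply le_antisymm
    · refine (hg (ι x)).2 ?_
      rintro d ⟨U, hU, hx, hd⟩
      exact hd.1 ⟨x, hx, rfl⟩
    · refine (hD.2.2.1 (f x)).2.2.2 ?_
      intro a ha
      obtain ⟨V, hV, hVe⟩ := hro (f ⁻¹' {z | WayBelow a z})
        ((@continuous_def X D _ (scottTopology D) f).1 hf _ (aux_scott hD a))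
      have hxV : x ∈ ι ⁻¹' V := hVe ▸ ha
      obtain ⟨d, hd⟩ := aux_star hD ι hdense f V hV (ι x) hxV
      refine le_trans (hd.2 ?_) ((hg (ι x)).1 ⟨V, hV, hxV, hd⟩)
      rintro _ ⟨z, hz, rfl⟩
      rw [← hVe] at hz
      exact (hD.2.2.1 (f z)).2.2.1 hz
  refine ⟨fun g g' _ _ h x => h _, ?_, key, ?_, ?_⟩
  · intro f f' g g' _ _ hg hg' h y
    refine (hg y).2 ?_
    rintro d ⟨U, hU, hy, hd⟩
    obtain ⟨d', hd'⟩ := aux_star hD ι hdense f' U hU y hy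
    refine le_trans (hd'.2 ?_) ((hg' y).1 ⟨U, hU, hy, hd'⟩)
    rintro _ ⟨z, hz, rfl⟩
    exact (hd.1 ⟨z, hz, rfl⟩).trans (h z)
  · intro f hf
    have hdir := aux_dir hD ι hdense f
    choose g hg using fun y => hD.2.1 (starSet ι f y) (hdir y).1 (hdir y).2
    refine ⟨g, ?_, key f g hf hg⟩
    refine (@continuous_def Y D _ (scottTopology D) g).2 fun O hO => ?_
    have hO' : IsScottOpen O := hO
    rw [isOpen_iff_forall_mem_open]
    intro y hy
    obtain ⟨d, ⟨U, hU, hyU, hd⟩, hdO⟩ := hO'.2 _ (hdir y).1 (hdir y).2 _ (hg y) hy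
    exact ⟨U, fun y' hy' => hO'.1 hdO ((hg y').1 ⟨U, hU, hy', hd⟩), hU, hyU⟩
  · intro f f' g hf hf' hg hg'
    funext x
    rw [← key f g hf hg x, key f' g hf' hg' x]
end

section
/- Let ι : X → Y be a dense quasi-embedding of topological spaces and D a bc-domain with its Scott topology. Then (·)^* and (·)_* form a Galois connection with (·)^* the left adjoint and (·)_* the right adjoint: for every f ∈ [X → D] and g ∈ [Y → D], g^* ⊑ f if and only if g ⊑ f_*. Moreover, the left adjoint (·)^* : [Y → D] → [X → D] is Scott continuous (it preserves suprema of directed sets). -/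
open Set TopologicalSpace

theorem wb_open {D : Type*} [PartialOrder D] (hD : IsBCDomain D) (d : D) :
    IsScottOpen {z : D | WayBelow d z} := by
  obtain ⟨-, -, hc, -⟩ := hD
  refine ⟨fun x hx y hxy A h1 h2 a h3 h4 => hx A h1 h2 a h3 (hxy.trans h4), ?_⟩
  intro A hA hdir a ha hda
  have hlub : IsLUB {b : D | ∃ a ∈ A, WayBelow b a} a := by
    constructor
    · rintro b ⟨c, hc1, hb⟩
      exact ((hc c).2.2.1 hb).trans (ha.1 hc1)
    · intro u hu
      exact ha.2 fun c hcA => (hc c).2.2.2 fun b hb => hu ⟨c, hcA, hb⟩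
  obtain ⟨b, ⟨c, hcA, hbc⟩, hdb⟩ := hda {b : D | ∃ a ∈ A, WayBelow b a} (by
      obtain ⟨c, hcA⟩ := hA
      obtain ⟨b, hb⟩ := (hc c).1
      exact ⟨b, c, hcA, hb⟩) (by
      rintro b1 ⟨c1, h1, hb1⟩ b2 ⟨c2, h2, hb2⟩
      obtain ⟨c, hcA, h1c, h2c⟩ := hdir c1 h1 c2 h2
      obtain ⟨b, hb, hh1, hh2⟩ := (hc c).2.1 b1
        (fun A k1 k2 a k3 k4 => hb1 A k1 k2 a k3 (le_trans h1c k4)) b2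
        (fun A k1 k2 a k3 k4 => hb2 A k1 k2 a k3 (le_trans h2c k4))
      exact ⟨b, ⟨c, hcA, hb⟩, hh1, hh2⟩) a hlub le_rfl
  refine ⟨c, hcA, fun A k1 k2 a k3 k4 => ?_⟩
  obtain ⟨e, he, hbe⟩ := hbc A k1 k2 a k3 k4
  exact ⟨e, he, hdb.trans hbe⟩

theorem exists_glb {D : Type*} [PartialOrder D] (hD : IsBCDomain D) (A : Set D)
    (hA : A.Nonempty) : ∃ a, IsGLB A a := by
  obtain ⟨x, hx⟩ := hA
  obtain ⟨a, ha⟩ := hD.2.2.2 (lowerBounds A) ⟨x, fun l hl => hl hx⟩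
  exact ⟨a, isLUB_lowerBounds.1 ha⟩

theorem pointwise_lub {Y D : Type*} [TopologicalSpace Y] [PartialOrder D] (hD : IsBCDomain D)
    (S : Set (CMap Y D)) (hS : S.Nonempty) (hdir : DirectedOn (· ≤ ·) S)
    (a : CMap Y D) (ha : IsLUB S a) (y : Y) : IsLUB ((fun s : CMap Y D => s.1 y) '' S) (a.1 y) := by
  have hne : ∀ y, ((fun s : CMap Y D => s.1 y) '' S).Nonempty := fun y => hS.image _
  have hd : ∀ y, DirectedOn (· ≤ ·) ((fun s : CMap Y D => s.1 y) '' S) := by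
    rintro y _ ⟨s, hs, rfl⟩ _ ⟨t, ht, rfl⟩
    obtain ⟨u, hu, h1, h2⟩ := hdir s hs t ht
    exact ⟨_, ⟨u, hu, rfl⟩, h1 y, h2 y⟩
  choose p hp using fun y => hD.2.1 _ (hne y) (hd y)
  have hpc : @Continuous Y D _ (scottTopology D) p := by
    letI := scottTopology D
    refine continuous_def.2 fun O hO => ?_
    have : p ⁻¹' O = ⋃ s ∈ S, s.1 ⁻¹' O := by
      ext z
      simp only [mem_preimage, mem_iUnion]
      constructor
      · intro hz
        obtain ⟨_, ⟨s, hs, rfl⟩, h⟩ := hO.2 _ (hne z) (hd z) _ (hp z) hz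
        exact ⟨s, hs, h⟩
      · rintro ⟨s, hs, h⟩
        exact hO.1 h ((hp z).1 ⟨s, hs, rfl⟩)
    rw [this]
    exact isOpen_biUnion fun s _ => hO.preimage s.2
  have hl : IsLUB S (⟨p, hpc⟩ : CMap Y D) :=
    ⟨fun s hs z => (hp z).1 ⟨s, hs, rfl⟩, fun u hu z => (hp z).2 (by
      rintro _ ⟨s, hs, rfl⟩
      exact hu hs z)⟩
  rw [ha.unique hl]
  exact hp y

/-- For a dense quasi-embedding `ι : X → Y` and a bc-domain `D`, the maps
`(·)^*` (restriction along `ι`) and `(·)_*` form a Galois connection between the function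
spaces `[Y → D]` and `[X → D]`: `g^* ⊑ f ↔ g ⊑ f_*`; moreover the left adjoint `(·)^*`
is Scott continuous (monotone and preserving suprema of directed sets). -/
theorem galoisConnection_functionSpaces
    {X Y D : Type*} [TopologicalSpace X] [TopologicalSpace Y] [PartialOrder D]
    (hD : IsBCDomain D)
    (ι : X → Y) (hcont : Continuous ι)
    (hro : ∀ U : Set X, IsOpen U → ∃ V : Set Y, IsOpen V ∧ U = ι ⁻¹' V)
    (hdense : Dense (Set.range ι))
    (res : CMap Y D → CMap X D) (hres : ∀ g : CMap Y D, (res g).1 = fun x : X => g.1 (ι x)) :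
    (∀ (f : CMap X D) (fst : CMap Y D),
      (∀ y : Y, IsLUB (starSet ι f.1 y) (fst.1 y)) →
      ∀ g : CMap Y D, (res g ≤ f ↔ g ≤ fst)) ∧
    Monotone res ∧
    (∀ S : Set (CMap Y D), S.Nonempty → DirectedOn (· ≤ ·) S →
      ∀ a : CMap Y D, IsLUB S a → IsLUB (res '' S) (res a)) := by
  have hr : ∀ (g : CMap Y D) x, (res g).1 x = g.1 (ι x) := fun g x => by rw [hres]
  have hmono : Monotone res := fun g h hgh x => by
    change (res g).1 x ≤ (res h).1 x
    rw [hr, hr]; exact hgh (ι x)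
  refine ⟨fun f fst hf g => ⟨fun hg y => ?_, fun hg x => ?_⟩, hmono, ?_⟩
  · refine (hD.2.2.1 (g.1 y)).2.2.2 fun d hd => ?_
    have hU : IsOpen (g.1 ⁻¹' {z : D | WayBelow d z}) :=
      @IsOpen.preimage _ _ _ (scottTopology D) _ g.2 _ (wb_open hD d)
    obtain ⟨_, hx, x, rfl⟩ := hdense.inter_open_nonempty _ hU ⟨y, hd⟩
    obtain ⟨m, hm⟩ := exists_glb hD (f.1 '' (ι ⁻¹' (g.1 ⁻¹' {z : D | WayBelow d z})))
      ⟨_, x, hx, rfl⟩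
    refine le_trans (hm.2 ?_) ((hf y).1 ⟨_, hU, hd, hm⟩)
    rintro _ ⟨x', hx', rfl⟩
    have h1 : (res g).1 x' ≤ f.1 x' := hg x'
    rw [hr] at h1
    exact ((hD.2.2.1 _).2.2.1 hx').trans h1
  · change (res g).1 x ≤ f.1 x
    rw [hr]
    refine le_trans (hg (ι x)) ((hf (ι x)).2 ?_)
    rintro d ⟨U, -, hxU, hd⟩
    exact hd.1 ⟨x, hxU, rfl⟩
  · intro S hS hdir a ha
    refine ⟨?_, fun u hu x => ?_⟩
    · rintro _ ⟨s, hs, rfl⟩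
      exact hmono (ha.1 hs)
    · change (res a).1 x ≤ u.1 x
      rw [hr]
      refine (pointwise_lub hD S hS hdir a ha (ι x)).2 ?_
      rintro _ ⟨s, hs, rfl⟩
      have h1 : (res s).1 x ≤ u.1 x := hu ⟨s, hs, rfl⟩ x
      rw [hr] at h1
      exact h1
end

section
/- Let Y be a core-compact topological space and B_Y a basis for the continuous lattice (τ_Y, ⊆) of open sets of Y; let D be a bc-domain with basis D₀ ⊆ D. Then every f ∈ [Y → D] satisfies f = ⊔{ b·χ_U : U ∈ B_Y, b ∈ D₀, U ≪ f⁻¹(↟b) }, where ↟b = { d ∈ D : b ≪ d }. Consequently, [Y → D] is a bc-domain having as a basis the step functions ⊔_{i∈I} b_i·χ_{U_i} for finite consistent families with all U_i ∈ B_Y and b_i ∈ D₀. -/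
open Set TopologicalSpace

section Aux

theorem cont_iff_aux {Y D : Type*} [TopologicalSpace Y] [Preorder D] (f : Y → D) :
    @Continuous Y D _ (scottTopology D) f ↔ ∀ O, IsScottOpen O → IsOpen (f ⁻¹' O) :=
  @continuous_def Y D _ (scottTopology D) f

theorem wb_le {α : Type*} [Preorder α] {x y : α} (h : WayBelow x y) : x ≤ y := by
  obtain ⟨d, hd, hxd⟩ := h {y} (singleton_nonempty y)
    (by intro a ha b hb; exact ⟨a, ha, le_refl _, by rw [ha, hb]⟩) y isLUB_singleton le_rfl
  rw [mem_singleton_iff] at hd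
  exact hd ▸ hxd

theorem wb_mono {α : Type*} [Preorder α] {x y z w : α} (h1 : x ≤ y) (h : WayBelow y z)
    (h2 : z ≤ w) : WayBelow x w := by
  intro A hA hd a ha hwa
  obtain ⟨d, hdA, h3⟩ := h A hA hd a ha (h2.trans hwa)
  exact ⟨d, hdA, h1.trans h3⟩

theorem scott_wb {D : Type*} [PartialOrder D] (hD : IsBCDomain D) (b : D) :
    IsScottOpen {d : D | WayBelow b d} := by
  obtain ⟨-, -, hc, -⟩ := hD
  refine ⟨fun x hx y hxy => wb_mono le_rfl hx hxy, ?_⟩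
  intro A hA hdir a ha hba
  obtain ⟨c, ⟨x, hxA, hcx⟩, hbc⟩ := hba {c | ∃ x ∈ A, WayBelow c x} (by
      obtain ⟨x, hx⟩ := hA
      obtain ⟨c, hc⟩ := (hc x).1
      exact ⟨c, x, hx, hc⟩) (by
      rintro c1 ⟨x1, hx1, h1⟩ c2 ⟨x2, hx2, h2⟩
      obtain ⟨x, hx, h3, h4⟩ := hdir x1 hx1 x2 hx2
      obtain ⟨c, hcx, h5, h6⟩ := (hc x).2.1 c1 (wb_mono le_rfl h1 h3) c2 (wb_mono le_rfl h2 h4)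
      exact ⟨c, ⟨x, hx, hcx⟩, h5, h6⟩) a (by
      constructor
      · rintro c ⟨x, hx, h⟩
        exact (wb_le h).trans (ha.1 hx)
      · intro u hu
        refine ha.2 fun x hx => (hc x).2.2.2 fun c hcx => hu ⟨x, hx, hcx⟩) le_rfl
  exact ⟨x, hxA, wb_mono hbc hcx le_rfl⟩

theorem lub_cont {Y D : Type*} [TopologicalSpace Y] [PartialOrder D]
    (hD : IsBCDomain D) (A : Set (Y → D))
    (hA : ∀ a ∈ A, @Continuous Y D _ (scottTopology D) a) (h : Y → D)
    (hh : ∀ y, IsLUB ((fun a : Y → D => a y) '' A) (h y)) :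
    @Continuous Y D _ (scottTopology D) h := by
  have hwb := scott_wb hD
  obtain ⟨⟨bot, hbot⟩, -, hc, hbc⟩ := hD
  rw [cont_iff_aux]
  intro O hO
  rw [isOpen_iff_forall_mem_open]
  intro y hy
  have hT : ∀ d, (∃ a ∈ A, WayBelow d (a y)) → d ≤ h y := by
    rintro d ⟨a, ha, hd⟩
    exact (wb_le hd).trans ((hh y).1 ⟨a, ha, rfl⟩)
  obtain ⟨e, ⟨s, hsf, hsT, hse⟩, heO⟩ := hO.2
    {e | ∃ s : Set D, s.Finite ∧ (∀ d ∈ s, ∃ a ∈ A, WayBelow d (a y)) ∧ IsLUB s e}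
    ⟨bot, ∅, finite_empty, by simp, by simp, fun u _ => hbot u⟩
    (by
      rintro e1 ⟨s1, hf1, hs1, he1⟩ e2 ⟨s2, hf2, hs2, he2⟩
      have hU : ∀ d ∈ s1 ∪ s2, ∃ a ∈ A, WayBelow d (a y) := by
        rintro d (hd | hd)
        · exact hs1 d hd
        · exact hs2 d hd
      obtain ⟨e, he⟩ := hbc (s1 ∪ s2) ⟨h y, fun d hd => hT d (hU d hd)⟩
      exact ⟨e, ⟨s1 ∪ s2, hf1.union hf2, hU, he⟩,
        he1.2 fun d hd => he.1 (Or.inl hd), he2.2 fun d hd => he.1 (Or.inr hd)⟩)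
    (h y)
    (by
      constructor
      · rintro e ⟨s, -, hs, he⟩
        exact he.2 fun d hd => hT d (hs d hd)
      · intro u hu
        refine (hh y).2 ?_
        rintro _ ⟨a, ha, rfl⟩
        refine (hc (a y)).2.2.2 fun d hd => ?_
        exact hu ⟨{d}, finite_singleton d, by
          intro d' hd'; rw [mem_singleton_iff] at hd'; subst hd'; exact ⟨a, ha, hd⟩,
          isLUB_singleton⟩)
    hy
  haveI : Nonempty (Y → D) := ⟨h⟩
  choose! g hgA hg using hsT
  refine ⟨⋂ d ∈ s, g d ⁻¹' {x | WayBelow d x}, ?_, ?_, ?_⟩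
  · intro z hz
    simp only [mem_iInter] at hz
    refine hO.1 heO (hse.2 fun d hd => ?_)
    exact (wb_le (hz d hd)).trans ((hh z).1 ⟨g d, hgA d hd, rfl⟩)
  · exact hsf.isOpen_biInter fun d hd => (cont_iff_aux _).1 (hA _ (hgA d hd)) _ (hwb d)
  · simp only [mem_iInter]
    exact fun d hd => hg d hd

theorem cmap_lub {Y D : Type*} [TopologicalSpace Y] [PartialOrder D]
    (hD : IsBCDomain D) (A : Set (CMap Y D))
    (hA : ∀ y, ∃ d, IsLUB ((fun a : CMap Y D => a.1 y) '' A) d) :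
    ∃ a : CMap Y D, IsLUB A a ∧ ∀ y, IsLUB ((fun a : CMap Y D => a.1 y) '' A) (a.1 y) := by
  choose h hh using hA
  have hcont : @Continuous Y D _ (scottTopology D) h := by
    refine lub_cont hD (Subtype.val '' A) ?_ h ?_
    · rintro _ ⟨a, _, rfl⟩
      exact a.2
    · intro y
      rw [image_image]
      exact hh y
  refine ⟨⟨h, hcont⟩, ⟨fun a ha y => (hh y).1 ⟨a, ha, rfl⟩, fun u hu y => (hh y).2 ?_⟩, hh⟩
  rintro _ ⟨a, ha, rfl⟩
  exact hu ha y

theorem cmap_dir {Y D : Type*} [TopologicalSpace Y] [PartialOrder D]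
    (hD : IsBCDomain D) (A : Set (CMap Y D)) (hne : A.Nonempty) (hdir : DirectedOn (· ≤ ·) A) (y : Y) :
    ((fun a : CMap Y D => a.1 y) '' A).Nonempty ∧
      DirectedOn (· ≤ ·) ((fun a : CMap Y D => a.1 y) '' A) := by
  refine ⟨hne.image _, ?_⟩
  rintro _ ⟨a, ha, rfl⟩ _ ⟨b, hb, rfl⟩
  obtain ⟨c, hc, h1, h2⟩ := hdir a ha b hb
  exact ⟨_, ⟨c, hc, rfl⟩, h1 y, h2 y⟩

theorem cmap_dir_lub {Y D : Type*} [TopologicalSpace Y] [PartialOrder D]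
    (hD : IsBCDomain D) (A : Set (CMap Y D)) (hne : A.Nonempty) (hdir : DirectedOn (· ≤ ·) A)
    (a : CMap Y D) (ha : IsLUB A a) (y : Y) :
    IsLUB ((fun a : CMap Y D => a.1 y) '' A) (a.1 y) := by
  obtain ⟨a', h1, h2⟩ := cmap_lub hD A fun y =>
    hD.2.1 _ (cmap_dir hD A hne hdir y).1 (cmap_dir hD A hne hdir y).2
  rw [ha.unique h1]
  exact h2 y

/-- The open set of points mapped way above `b`. -/
def upOp {Y D : Type*} [TopologicalSpace Y] [PartialOrder D]
    (hD : IsBCDomain D) (f : CMap Y D) (b : D) : Opens Y :=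
  ⟨f.1 ⁻¹' {d : D | WayBelow b d}, (cont_iff_aux _).1 f.2 _ (scott_wb hD b)⟩

theorem exists_open {Y D : Type*} [TopologicalSpace Y] [PartialOrder D]
    (BY : Set (Opens Y)) (hBY : IsBasisFor BY)
    (hD : IsBCDomain D) (f : CMap Y D) (b : D) (y : Y) (h : WayBelow b (f.1 y)) :
    ∃ U ∈ BY, WayBelow U (upOp hD f b) ∧ y ∈ U := by
  have h1 := (hBY (upOp hD f b)).2.2
  have h2 : y ∈ upOp hD f b := h
  rw [← h1.sSup_eq, Opens.mem_sSup] at h2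
  obtain ⟨U, hU, hy⟩ := h2
  exact ⟨U, hU.1, hU.2, hy⟩

theorem step_le {Y D : Type*} [TopologicalSpace Y] [PartialOrder D] [OrderBot D]
    (b : D) (U : Opens Y) (f : Y → D) (h : ∀ y ∈ U, b ≤ f y) (y : Y) :
    stepFn b (U : Set Y) y ≤ f y := by
  unfold stepFn
  split_ifs with hy
  · exact h y hy
  · exact bot_le

theorem step_eq {Y D : Type*} [TopologicalSpace Y] [PartialOrder D] [OrderBot D]
    (b : D) (U : Opens Y) (y : Y) (hy : y ∈ U) : stepFn b (U : Set Y) y = b :=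
  if_pos hy

theorem step_cont {Y D : Type*} [TopologicalSpace Y] [PartialOrder D] [OrderBot D]
    (b : D) (U : Opens Y) : @Continuous Y D _ (scottTopology D) (stepFn b (U : Set Y)) := by
  rw [cont_iff_aux]
  intro O hO
  by_cases hb : (⊥ : D) ∈ O
  · convert isOpen_univ
    ext y
    simpa using hO.1 hb bot_le
  · by_cases hb' : b ∈ O
    · convert U.2
      ext y
      simp only [mem_preimage, stepFn]
      split_ifs with h <;> simp_all
    · convert isOpen_empty
      ext y
      simp only [mem_preimage, stepFn]
      split_ifs with h <;> simp_all

/-- `F` is the pointwise join of the finite family `s`. -/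
def IsJoin {Y D : Type*} [TopologicalSpace Y] [PartialOrder D] [OrderBot D]
    (s : Finset (D × Opens Y)) (F : CMap Y D) : Prop :=
  ∀ y : Y, IsLUB ((fun p : D × Opens Y => stepFn p.1 (p.2 : Set Y) y) '' ↑s) (F.1 y)

/-- Admissible families for `f`. -/
def Adm {Y D : Type*} [TopologicalSpace Y] [PartialOrder D]
    (BY : Set (Opens Y)) (hD : IsBCDomain D) (D₀ : Set D) (f : CMap Y D)
    (s : Finset (D × Opens Y)) : Prop :=
  ∀ p ∈ s, p.1 ∈ D₀ ∧ p.2 ∈ BY ∧ WayBelow p.2 (upOp hD f p.1)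

variable {Y D : Type*} [TopologicalSpace Y] [PartialOrder D] [OrderBot D]
    (BY : Set (Opens Y)) (hD : IsBCDomain D) (D₀ : Set D)

theorem adm_le (f : CMap Y D) (s : Finset (D × Opens Y)) (hs : Adm BY hD D₀ f s)
    (p) (hp : p ∈ s) (y : Y) : stepFn p.1 (p.2 : Set Y) y ≤ f.1 y :=
  step_le _ _ _ (fun y hy => wb_le (show WayBelow p.1 (f.1 y) from wb_le (hs p hp).2.2 hy)) y

theorem adm_join (f : CMap Y D) (s : Finset (D × Opens Y)) (hs : Adm BY hD D₀ f s) :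
    ∃ F : CMap Y D, IsJoin s F := by
  have : ∀ y, ∃ d, IsLUB ((fun p : D × Opens Y => stepFn p.1 (p.2 : Set Y) y) '' ↑s) d := by
    intro y
    refine hD.2.2.2 _ ⟨f.1 y, ?_⟩
    rintro _ ⟨p, hp, rfl⟩
    exact adm_le BY hD D₀ f s hs p hp y
  choose h hh using this
  refine ⟨⟨h, lub_cont hD ((fun p : D × Opens Y => stepFn p.1 (p.2 : Set Y)) '' ↑s) ?_ h ?_⟩, hh⟩
  · rintro _ ⟨p, _, rfl⟩
    exact step_cont _ _
  · intro y
    rw [image_image]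
    exact hh y

theorem single_wb (f : CMap Y D) (b : D) (U : Opens Y) (hU : WayBelow U (upOp hD f b))
    (A : Set (CMap Y D)) (hne : A.Nonempty) (hdir : DirectedOn (· ≤ ·) A)
    (a : CMap Y D) (ha : IsLUB A a) (hfa : f ≤ a) :
    ∃ d ∈ A, ∀ y, stepFn b (U : Set Y) y ≤ d.1 y := by
  obtain ⟨_, ⟨d, hd, rfl⟩, hUd⟩ := hU ((fun g => upOp hD g b) '' A) (hne.image _) (by
      rintro _ ⟨g, hg, rfl⟩ _ ⟨k, hk, rfl⟩
      obtain ⟨c, hc, h1, h2⟩ := hdir g hg k hk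
      exact ⟨_, ⟨c, hc, rfl⟩, fun y hy => wb_mono le_rfl hy (h1 y),
        fun y hy => wb_mono le_rfl hy (h2 y)⟩) _ (isLUB_sSup _) (by
      intro y hy
      have hy' : WayBelow b (a.1 y) := wb_mono le_rfl hy (hfa y)
      obtain ⟨hn, hdd⟩ := cmap_dir hD A hne hdir y
      obtain ⟨_, ⟨g, hg, rfl⟩, hb⟩ := (scott_wb hD b).2 _ hn hdd _
        (cmap_dir_lub hD A hne hdir a ha y) hy'
      exact Opens.mem_sSup.2 ⟨_, ⟨g, hg, rfl⟩, hb⟩)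
  exact ⟨d, hd, step_le _ _ _ fun y hy => wb_le (show WayBelow b (d.1 y) from hUd hy)⟩

theorem join_wb (f : CMap Y D) (s : Finset (D × Opens Y)) (hs : Adm BY hD D₀ f s)
    (F : CMap Y D) (hF : IsJoin s F) : WayBelow F f := by
  classical
  intro A hne hdir a ha hfa
  have key : ∀ t ⊆ s, ∃ d ∈ A, ∀ p ∈ t, ∀ y, stepFn p.1 (p.2 : Set Y) y ≤ d.1 y := by
    intro t
    induction t using Finset.induction_on with
    | empty =>
      intro _
      obtain ⟨d, hd⟩ := hne
      exact ⟨d, hd, by simp⟩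
    | insert p t _ ih =>
      intro hts
      obtain ⟨d1, hd1, h1⟩ := ih fun q hq => hts (Finset.mem_insert_of_mem hq)
      obtain ⟨d2, hd2, h2⟩ := single_wb hD f p.1 p.2
        (hs p (hts (Finset.mem_insert_self _ _))).2.2 A hne hdir a ha hfa
      obtain ⟨d, hd, h3, h4⟩ := hdir d1 hd1 d2 hd2
      refine ⟨d, hd, fun q hq y => ?_⟩
      rcases Finset.mem_insert.1 hq with rfl | hq
      · exact (h2 y).trans (h4 y)
      · exact (h1 q hq y).trans (h3 y)
  obtain ⟨d, hd, h⟩ := key s subset_rfl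
  refine ⟨d, hd, fun y => (hF y).2 ?_⟩
  rintro _ ⟨p, hp, rfl⟩
  exact h p hp y

theorem basis_aux (hBY : IsBasisFor BY) (hD₀ : IsBasisFor D₀) (B : Set (CMap Y D)) (f : CMap Y D)
    (hB : ∀ s F, Adm BY hD D₀ f s → IsJoin s F → F ∈ B) :
    {b | b ∈ B ∧ WayBelow b f}.Nonempty ∧
    DirectedOn (· ≤ ·) {b | b ∈ B ∧ WayBelow b f} ∧
    IsLUB {b | b ∈ B ∧ WayBelow b f} f := by
  classical
  set S : Set (CMap Y D) := {F | ∃ s, Adm BY hD D₀ f s ∧ IsJoin s F} with hS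
  have hSB : ∀ F ∈ S, F ∈ B ∧ WayBelow F f := by
    rintro F ⟨s, hs, hF⟩
    exact ⟨hB s F hs hF, join_wb BY hD D₀ f s hs F hF⟩
  have hSne : S.Nonempty := by
    have h0 : Adm BY hD D₀ f ∅ := by intro p hp; simp at hp
    obtain ⟨F, hF⟩ := adm_join BY hD D₀ f ∅ h0
    exact ⟨F, ∅, h0, hF⟩
  have hSdir : DirectedOn (· ≤ ·) S := by
    rintro F1 ⟨s1, h1, hF1⟩ F2 ⟨s2, h2, hF2⟩
    have h0 : Adm BY hD D₀ f (s1 ∪ s2) := by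
      intro p hp
      rcases Finset.mem_union.1 hp with hp | hp
      · exact h1 p hp
      · exact h2 p hp
    obtain ⟨F, hF⟩ := adm_join BY hD D₀ f _ h0
    refine ⟨F, ⟨_, h0, hF⟩, fun y => (hF1 y).2 ?_, fun y => (hF2 y).2 ?_⟩
    · rintro _ ⟨p, hp, rfl⟩
      exact (hF y).1 ⟨p, Finset.mem_coe.2 (Finset.mem_union_left _ hp), rfl⟩
    · rintro _ ⟨p, hp, rfl⟩
      exact (hF y).1 ⟨p, Finset.mem_coe.2 (Finset.mem_union_right _ hp), rfl⟩
  have hSlub : IsLUB S f := by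
    refine ⟨fun F hF => wb_le (hSB F hF).2, fun G hG y => (hD₀ (f.1 y)).2.2.2 ?_⟩
    rintro b ⟨hb, hbf⟩
    obtain ⟨U, hU, hUw, hyU⟩ := exists_open BY hBY hD f b y hbf
    have h0 : Adm BY hD D₀ f {(b, U)} := by
      intro p hp
      rw [Finset.mem_singleton] at hp
      subst hp
      exact ⟨hb, hU, hUw⟩
    obtain ⟨F, hF⟩ := adm_join BY hD D₀ f _ h0
    have h1 : b ≤ F.1 y := by
      have := (hF y).1 ⟨(b, U), by simp, rfl⟩
      simpa only [step_eq b U y hyU] using this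
    exact h1.trans (hG ⟨_, h0, hF⟩ y)
  refine ⟨?_, ?_, ?_⟩
  · obtain ⟨F, hF⟩ := hSne
    exact ⟨F, hSB F hF⟩
  · rintro F1 ⟨_, h1⟩ F2 ⟨_, h2⟩
    obtain ⟨G1, hG1, h3⟩ := h1 S hSne hSdir f hSlub le_rfl
    obtain ⟨G2, hG2, h4⟩ := h2 S hSne hSdir f hSlub le_rfl
    obtain ⟨G, hG, h5, h6⟩ := hSdir G1 hG1 G2 hG2
    exact ⟨G, hSB G hG, h3.trans h5, h4.trans h6⟩
  · exact ⟨fun F hF => wb_le hF.2, fun u hu => hSlub.2 fun F hF => hu (hSB F hF)⟩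

end Aux

/-- Let `Y` be core-compact with `B_Y` a basis of the continuous lattice of
opens and `D` a bc-domain with basis `D₀`. Every continuous `f : Y → D` is the supremum of
the single-step functions `b·χ_U` with `U ∈ B_Y`, `b ∈ D₀`, `U ≪ f⁻¹(↟b)`; consequently
`[Y → D]` is a bc-domain with a basis of step functions (finite consistent joins of
single-step functions with data from `B_Y` and `D₀`). -/
theorem stepFunction_basis
    {Y D : Type*} [TopologicalSpace Y] [PartialOrder D] [OrderBot D]
    (hY : IsContinuousLattice (TopologicalSpace.Opens Y))
    (BY : Set (TopologicalSpace.Opens Y)) (hBY : IsBasisFor BY)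
    (hD : IsBCDomain D) (D₀ : Set D) (hD₀ : IsBasisFor D₀) :
    (∀ f : Y → D, @Continuous Y D _ (scottTopology D) f →
      IsLUB {g : Y → D |
        ∃ (U : TopologicalSpace.Opens Y) (b : D), U ∈ BY ∧ b ∈ D₀ ∧
          (∃ hb : IsOpen (f ⁻¹' {d : D | WayBelow b d}),
            WayBelow U (⟨f ⁻¹' {d : D | WayBelow b d}, hb⟩ : TopologicalSpace.Opens Y)) ∧
          g = stepFn b (U : Set Y)} f) ∧
    IsBCDomain (CMap Y D) ∧
    IsBasisFor {F : CMap Y D |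
      ∃ s : Finset (D × TopologicalSpace.Opens Y),
        (∀ p ∈ s, p.1 ∈ D₀ ∧ p.2 ∈ BY) ∧
        (∀ t ⊆ s, (⋂ p ∈ t, (p.2 : Set Y)).Nonempty → ∃ bd : D, ∀ p ∈ t, p.1 ≤ bd) ∧
        (∀ y : Y,
          IsLUB ((fun p : D × TopologicalSpace.Opens Y => stepFn p.1 (p.2 : Set Y) y) '' ↑s)
            (F.1 y))} := by
  refine ⟨?_, ⟨?_, ?_, ?_, ?_⟩, ?_⟩
  · intro f hf
    constructor
    · rintro g ⟨U, b, hU, hb, ⟨hb', hw⟩, rfl⟩ y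
      exact step_le _ _ _ (fun y hy => wb_le (show WayBelow b (f y) from wb_le hw hy)) y
    · intro g hg y
      refine (hD₀ (f y)).2.2.2 ?_
      rintro b ⟨hb, hbf⟩
      obtain ⟨U, hU, hUw, hyU⟩ := exists_open BY hBY hD ⟨f, hf⟩ b y hbf
      have := hg ⟨U, b, hU, hb, ⟨(upOp hD ⟨f, hf⟩ b).2, hUw⟩, rfl⟩ y
      rwa [step_eq b U y hyU] at this
  · exact ⟨⟨stepFn ⊥ ((⊤ : Opens Y) : Set Y), step_cont _ _⟩,
      fun f y => step_le _ _ _ (fun _ _ => bot_le) y⟩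
  · intro A hne hdir
    obtain ⟨a, ha, -⟩ := cmap_lub hD A fun y =>
      hD.2.1 _ (cmap_dir hD A hne hdir y).1 (cmap_dir hD A hne hdir y).2
    exact ⟨a, ha⟩
  · intro f
    simpa using basis_aux BY hD D₀ hBY hD₀ univ f fun _ _ _ _ => mem_univ _
  · rintro A ⟨u, hu⟩
    obtain ⟨a, ha, -⟩ := cmap_lub hD A fun y => hD.2.2.2 _ ⟨u.1 y, by
      rintro _ ⟨a, ha, rfl⟩
      exact hu ha y⟩
    exact ⟨a, ha⟩
  · intro f
    refine basis_aux BY hD D₀ hBY hD₀ _ f ?_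
    intro s F hs hF
    refine ⟨s, fun p hp => ⟨(hs p hp).1, (hs p hp).2.1⟩, ?_, hF⟩
    rintro t hts ⟨y, hy⟩
    simp only [mem_iInter] at hy
    refine ⟨f.1 y, fun p hp => ?_⟩
    have := adm_le BY hD D₀ f s hs p (hts hp) y
    rwa [step_eq p.1 p.2 y (hy p hp)] at this
end

section
/- Let ι : X → Y be a dense quasi-embedding of topological spaces, where Y is core-compact, and let D be a bc-domain with more than one element. If the right adjoint (·)_* : [X → D] → [Y → D] of the Galois connection given by g^* = g ∘ ι and f_*(y) = ⊔{ ⊓ f(ι⁻¹(U)) : y ∈ U open in Y } is Scott continuous, then X is core-compact. -/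
open Set TopologicalSpace

theorem aux_cont {X D : Type*} [TopologicalSpace X] [PartialOrder D] (bt : D)
    (hbt : ∀ x : D, bt ≤ x) (g : X → D) (hg : @Continuous X D _ (scottTopology D) g)
    (N : Set X) (hN : IsOpen N) (h : X → D) (h1 : ∀ x ∈ N, h x = g x)
    (h2 : ∀ x, x ∉ N → h x = bt) : @Continuous X D _ (scottTopology D) h := by
  letI := scottTopology D
  refine ⟨fun O hO => ?_⟩
  by_cases hb : bt ∈ O
  · have : h ⁻¹' O = Set.univ := by
      ext x
      simp only [Set.mem_preimage, Set.mem_univ, iff_true]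
      exact (show IsScottOpen O from hO).1 hb (hbt _)
    rw [this]; exact isOpen_univ
  · have : h ⁻¹' O = N ∩ g ⁻¹' O := by
      ext x
      simp only [Set.mem_preimage, Set.mem_inter_iff]
      by_cases hx : x ∈ N
      · simp [h1 x hx, hx]
      · simp [h2 x hx, hx, hb]
    rw [this]; exact hN.inter (hO.preimage hg)

theorem aux_open {D : Type*} [PartialOrder D] (bt : D) (hbt : ∀ x : D, bt ≤ x) :
    IsScottOpen {d : D | d ≠ bt} := by
  refine ⟨?_, ?_⟩
  · intro x hx y hxy hy
    subst hy
    exact hx (le_antisymm hxy (hbt _))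
  · intro A _ _ a ha hne
    by_contra hcon
    apply hne
    refine le_antisymm (ha.2 ?_) (hbt _)
    intro d hd
    by_contra hd'
    exact hcon ⟨d, hd, fun h => hd' (le_of_eq h)⟩

/-- Let `ι : X → Y` be a dense quasi-embedding with `Y` core-compact, and
`D` a bc-domain with more than one element. If the right adjoint `(·)_*` of the Galois
connection (characterized by `f_*(y) = ⊔ starSet ι f y`) is Scott continuous, then `X`
is core-compact. -/
theorem coreCompact_of_scottContinuous_rightAdjoint
    {X Y D : Type*} [TopologicalSpace X] [TopologicalSpace Y] [PartialOrder D]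
    (hD : IsBCDomain D) (hD2 : ∃ a b : D, a ≠ b)
    (hY : IsContinuousLattice (TopologicalSpace.Opens Y))
    (ι : X → Y) (hcont : Continuous ι)
    (hro : ∀ U : Set X, IsOpen U → ∃ V : Set Y, IsOpen V ∧ U = ι ⁻¹' V)
    (hdense : Dense (Set.range ι))
    (star : CMap X D → CMap Y D)
    (hstar : ∀ (f : CMap X D) (y : Y), IsLUB (starSet ι f.1 y) ((star f).1 y))
    (hmono : Monotone star)
    (hscott : ∀ S : Set (CMap X D), S.Nonempty → DirectedOn (· ≤ ·) S →
      ∀ a : CMap X D, IsLUB S a → IsLUB (star '' S) (star a)) :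
    IsContinuousLattice (TopologicalSpace.Opens X) := by
  classical
  obtain ⟨⟨bt, hbt⟩, -, -, -⟩ := hD
  obtain ⟨b, hb⟩ : ∃ b : D, b ≠ bt := by
    obtain ⟨p, q, hpq⟩ := hD2
    by_cases hp : p = bt
    · exact ⟨q, fun h => hpq (hp.trans h.symm)⟩
    · exact ⟨p, hp⟩
  let F : Opens X → CMap X D := fun A =>
    ⟨fun x => if x ∈ A then b else bt,
      aux_cont bt hbt (fun _ => b) (@continuous_const _ _ _ (scottTopology D) b) (A : Set X) A.2 _
        (fun x hx => if_pos hx) (fun x hx => if_neg hx)⟩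
  have hFin : ∀ A x, x ∈ A → (F A).1 x = b := fun A x hx => if_pos hx
  have hFout : ∀ A x, x ∉ A → (F A).1 x = bt := fun A x hx => if_neg hx
  have hFmono : Monotone F := by
    intro A B hAB x
    by_cases hx : x ∈ A
    · rw [hFin A x hx, hFin B x (hAB hx)]
    · rw [hFout A x hx]; exact hbt _
  let O : Opens X → Opens Y := fun A =>
    ⟨{y | (star (F A)).1 y ≠ bt},
      @IsOpen.preimage Y D _ (scottTopology D) _ (star (F A)).2 _ (aux_open bt hbt)⟩
  have hOmono : Monotone O := by
    intro A B hAB y hy hy'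
    apply hy
    exact le_antisymm ((hmono (hFmono hAB) y).trans (le_of_eq hy')) (hbt _)
  have key : ∀ (U : Opens X) (x : X), x ∈ U → ∃ W : Opens X, WayBelow W U ∧ x ∈ W := by
    intro U x hx
    obtain ⟨V, hV, hUV⟩ := hro U U.2
    have hxV : ι x ∈ V := by
      have : x ∈ (U : Set X) := hx
      rwa [hUV] at this
    obtain ⟨W, hW, hxW⟩ : ∃ W : Opens Y, WayBelow W (⟨V, hV⟩ : Opens Y) ∧ ι x ∈ W := by
      have h := (hY ⟨V, hV⟩).2.2
      have hm : ι x ∈ (⟨V, hV⟩ : Opens Y) := hxV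
      rw [← h.sSup_eq, Opens.mem_sSup] at hm
      exact hm
    refine ⟨⟨ι ⁻¹' W, W.2.preimage hcont⟩, ?_, hxW⟩
    intro 𝒜 hne hdir a ha hUa
    have haS : ∀ z, z ∈ a → ∃ A ∈ 𝒜, z ∈ A := by
      intro z hz
      rw [← ha.sSup_eq, Opens.mem_sSup] at hz
      exact hz
    have hlub : IsLUB (F '' 𝒜) (F a) := by
      refine ⟨?_, ?_⟩
      · rintro _ ⟨A, hA, rfl⟩
        exact hFmono (ha.1 hA)
      · intro g hg z
        by_cases hz : z ∈ a
        · obtain ⟨A, hA, hzA⟩ := haS z hz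
          have := hg (Set.mem_image_of_mem F hA) z
          rw [hFin A z hzA] at this
          rw [hFin a z hz]; exact this
        · rw [hFout a z hz]; exact hbt _
    have hdirF : DirectedOn (· ≤ ·) (F '' 𝒜) := by
      rintro _ ⟨A, hA, rfl⟩ _ ⟨B, hB, rfl⟩
      obtain ⟨C, hC, h1, h2⟩ := hdir A hA B hB
      exact ⟨_, Set.mem_image_of_mem F hC, hFmono h1, hFmono h2⟩
    have hs := hscott _ (hne.image F) hdirF _ hlub
    have hdirO : DirectedOn (· ≤ ·) (O '' 𝒜) := by
      rintro _ ⟨A, hA, rfl⟩ _ ⟨B, hB, rfl⟩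
      obtain ⟨C, hC, h1, h2⟩ := hdir A hA B hB
      exact ⟨_, Set.mem_image_of_mem O hC, hOmono h1, hOmono h2⟩
    have hcover : (⟨V, hV⟩ : Opens Y) ≤ sSup (O '' 𝒜) := by
      intro v hv
      by_contra hvN
      let N : Opens Y := sSup (O '' 𝒜)
      let h : CMap Y D := ⟨fun y => if y ∈ N then (star (F a)).1 y else bt,
        aux_cont bt hbt _ (star (F a)).2 (N : Set Y) N.2 _
          (fun x hx => if_pos hx) (fun x hx => if_neg hx)⟩
      have hub : h ∈ upperBounds (star '' (F '' 𝒜)) := by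
        rintro _ ⟨_, ⟨A, hA, rfl⟩, rfl⟩ y
        change (star (F A)).1 y ≤ if y ∈ N then (star (F a)).1 y else bt
        by_cases hy : y ∈ N
        · rw [if_pos hy]
          exact hmono (hFmono (ha.1 hA)) y
        · rw [if_neg hy]
          by_contra hcon
          exact hy (Opens.mem_sSup.2 ⟨O A, Set.mem_image_of_mem O hA,
            fun h => hcon (le_of_eq h)⟩)
      have h1 : (star (F a)).1 v ≤ if v ∈ N then (star (F a)).1 v else bt := hs.2 hub v
      rw [if_neg hvN] at h1
      have himg : (F a).1 '' (ι ⁻¹' V) = {b} := by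
        rw [← hUV]
        ext d
        constructor
        · rintro ⟨z, hz, rfl⟩
          exact hFin a z (hUa hz)
        · intro hd
          exact ⟨x, hx, (hFin a x (hUa hx)).trans hd.symm⟩
      have h2 : b ≤ (star (F a)).1 v :=
        (hstar (F a) v).1 ⟨V, hV, hv, by rw [himg]; exact isGLB_singleton⟩
      exact hb (le_antisymm (h2.trans h1) (hbt _))
    obtain ⟨_, ⟨A, hA, rfl⟩, hWA⟩ := hW _ (hne.image O) hdirO _ (isLUB_sSup _) hcover
    refine ⟨A, hA, ?_⟩
    intro z hz
    have hz' : (star (F A)).1 (ι z) ≠ bt := hWA hz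
    by_contra hzA
    apply hz'
    refine le_antisymm ((hstar (F A) (ι z)).2 ?_) (hbt _)
    rintro d ⟨U', -, hzU', hd⟩
    have := hd.1 (Set.mem_image_of_mem (F A).1 (show z ∈ ι ⁻¹' U' from hzU'))
    rwa [hFout A z hzA] at this
  intro U
  refine ⟨⟨⊥, ?_⟩, ?_, ?_, ?_⟩
  · rintro A ⟨d, hd⟩ - - - -
    exact ⟨d, hd, bot_le⟩
  · intro P hP Q hQ
    refine ⟨P ⊔ Q, ?_, le_sup_left, le_sup_right⟩
    intro A hA hdir a ha hUa
    obtain ⟨p, hp, hPp⟩ := hP A hA hdir a ha hUa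
    obtain ⟨q, hq, hQq⟩ := hQ A hA hdir a ha hUa
    obtain ⟨r, hr, h1, h2⟩ := hdir p hp q hq
    exact ⟨r, hr, sup_le (hPp.trans h1) (hQq.trans h2)⟩
  · intro P hP
    obtain ⟨d, hd, hPd⟩ := hP {U} ⟨U, rfl⟩ (directedOn_singleton U) U isLUB_singleton le_rfl
    rw [Set.mem_singleton_iff] at hd
    exact hd ▸ hPd
  · intro B hB x hx
    obtain ⟨W, hW, hxW⟩ := key U x hx
    exact hB hW hxW
end

section
/- Let X be a topological space and Ω₀ a ring of open sets of X. For every x ∈ X, the set ι(x) = { I ∈ Idl(Ω₀) : x ∈ ⋃I } is a completely prime filter of the complete lattice Idl(Ω₀). -/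
open Set TopologicalSpace

/-- A ring of open sets of `X`: a collection of open sets closed under finite unions
and finite intersections (hence containing `∅` and `X`). -/
structure IsOpenRing (X : Type*) [TopologicalSpace X] (Ω₀ : Set (Set X)) : Prop where
  isOpen : ∀ U ∈ Ω₀, IsOpen U
  empty_mem : (∅ : Set X) ∈ Ω₀
  univ_mem : (Set.univ : Set X) ∈ Ω₀
  union_mem : ∀ U ∈ Ω₀, ∀ V ∈ Ω₀, U ∪ V ∈ Ω₀
  inter_mem : ∀ U ∈ Ω₀, ∀ V ∈ Ω₀, U ∩ V ∈ Ω₀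

/-- An ideal of the poset `(Ω₀, ⊆)`: a nonempty, downward-closed, directed subset. -/
structure IsIdealOn {X : Type*} (Ω₀ : Set (Set X)) (I : Set (Set X)) : Prop where
  subset : I ⊆ Ω₀
  nonempty : I.Nonempty
  lower : ∀ U ∈ I, ∀ V ∈ Ω₀, V ⊆ U → V ∈ I
  directed : ∀ U ∈ I, ∀ V ∈ I, ∃ W ∈ I, U ⊆ W ∧ V ⊆ W

/-- `Idl Ω₀`: the ideals of `Ω₀`, ordered by inclusion (the subtype order). -/
abbrev Idl {X : Type*} (Ω₀ : Set (Set X)) : Type _ := {I : Set (Set X) // IsIdealOn Ω₀ I}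

/-- A completely prime filter of the complete lattice `Idl Ω₀`. -/
structure IsCPFilter {X : Type*} (Ω₀ : Set (Set X)) (F : Set (Idl Ω₀)) : Prop where
  nonempty : F.Nonempty
  upper : ∀ I ∈ F, ∀ J : Idl Ω₀, I ≤ J → J ∈ F
  inf_mem : ∀ I ∈ F, ∀ J ∈ F, ∀ K : Idl Ω₀, IsGLB {I, J} K → K ∈ F
  prime : ∀ A : Set (Idl Ω₀), ∀ I : Idl Ω₀, IsLUB A I → I ∈ F → ∃ J ∈ A, J ∈ F

/-- The points of `Idl Ω₀`: its completely prime filters. -/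
abbrev Pt {X : Type*} (Ω₀ : Set (Set X)) : Type _ := {F : Set (Idl Ω₀) // IsCPFilter Ω₀ F}

/-- The hull-kernel basic open set `O_I = { y : I ∈ y }`. -/
def ptOpen {X : Type*} {Ω₀ : Set (Set X)} (I : Idl Ω₀) : Set (Pt Ω₀) := {y : Pt Ω₀ | I ∈ y.1}

/-- The hull-kernel topology on `Pt Ω₀`, whose open sets are the sets `O_I`. -/
def hullKernel {X : Type*} (Ω₀ : Set (Set X)) : TopologicalSpace (Pt Ω₀) :=
  TopologicalSpace.generateFrom {V : Set (Pt Ω₀) | ∃ I : Idl Ω₀, V = ptOpen I}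

/-- The (principal) ideal `↓W = { U ∈ Ω₀ : U ⊆ W }` determined by a set `W`. -/
def principalIdl {X : Type*} [TopologicalSpace X] {Ω₀ : Set (Set X)} (hΩ : IsOpenRing X Ω₀)
    (W : Set X) : Idl Ω₀ :=
  ⟨{U : Set X | U ∈ Ω₀ ∧ U ⊆ W},
    { subset := fun U hU => hU.1
      nonempty := ⟨∅, hΩ.empty_mem, Set.empty_subset W⟩
      lower := fun U hU V hV hVU => ⟨hV, hVU.trans hU.2⟩
      directed := fun U hU V hV =>
        ⟨U ∪ V, ⟨hΩ.union_mem U hU.1 V hV.1, Set.union_subset hU.2 hV.2⟩,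
          Set.subset_union_left, Set.subset_union_right⟩ }⟩

/-- For a ring `Ω₀` of open sets of `X` and `x ∈ X`, the set
`ι(x) = { I ∈ Idl(Ω₀) : x ∈ ⋃I }` is a completely prime filter of `Idl(Ω₀)`. -/
theorem iota_isCPFilter {X : Type*} [TopologicalSpace X] {Ω₀ : Set (Set X)}
    (hΩ : IsOpenRing X Ω₀) (x : X) :
    IsCPFilter Ω₀ {I : Idl Ω₀ | x ∈ ⋃₀ I.1} := by
  refine ⟨⟨principalIdl hΩ Set.univ, Set.univ, ⟨hΩ.univ_mem, subset_rfl⟩, trivial⟩, ?_, ?_, ?_⟩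
  · rintro I ⟨U, hU, hx⟩ J hIJ
    exact ⟨U, hIJ hU, hx⟩
  · rintro I ⟨U, hU, hxU⟩ J ⟨V, hV, hxV⟩ K hK
    have hUV : U ∩ V ∈ Ω₀ := hΩ.inter_mem U (I.2.subset hU) V (J.2.subset hV)
    have h : principalIdl hΩ (U ∩ V) ≤ K := by
      apply hK.2
      rintro L (rfl | rfl)
      · intro W hW
        exact L.2.lower U hU W hW.1 (hW.2.trans Set.inter_subset_left)
      · intro W hW
        exact L.2.lower V hV W hW.1 (hW.2.trans Set.inter_subset_right)
    exact ⟨U ∩ V, h ⟨hUV, subset_rfl⟩, hxU, hxV⟩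
  · rintro A I hI ⟨U, hU, hxU⟩
    by_contra hcon
    have h : I ≤ principalIdl hΩ {x}ᶜ := by
      apply hI.2
      intro J hJ W hW
      refine ⟨J.2.subset hW, ?_⟩
      rintro y hy rfl
      exact hcon ⟨J, hJ, W, hW, hy⟩
    exact (h hU).2 hxU rfl
end

section
/- Let X be a topological space and Ω₀ a viable base of X (a ring of open sets that is also a base for the topology), and let ι : X → X̂_{Ω₀} be given by ι(x) = { I ∈ Idl(Ω₀) : x ∈ ⋃I }. Then for every ideal I ∈ Idl(Ω₀), O_I ∩ ι(X) = ι(⋃I); consequently ι(X) is dense in X̂_{Ω₀} (every nonempty hull-kernel open set meets ι(X)). -/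
open Set TopologicalSpace

/-- For a viable base `Ω₀` of `X`, the map `ι : X → X̂_{Ω₀}` satisfies
`O_I ∩ ι(X) = ι(⋃I)` for every ideal `I`; consequently `ι(X)` is dense in `X̂_{Ω₀}`:
every nonempty hull-kernel open set meets `ι(X)`. -/
theorem iota_dense {X : Type*} [TopologicalSpace X] {Ω₀ : Set (Set X)}
    (hΩ : IsOpenRing X Ω₀)
    (hbase : ∀ U : Set X, IsOpen U → ∀ x ∈ U, ∃ W ∈ Ω₀, x ∈ W ∧ W ⊆ U)
    (ι : X → Pt Ω₀)
    (hι : ∀ x : X, (ι x).1 = {I : Idl Ω₀ | x ∈ ⋃₀ I.1}) :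
    (∀ I : Idl Ω₀, ptOpen I ∩ Set.range ι = ι '' (⋃₀ I.1)) ∧
    (∀ V : Set (Pt Ω₀), @IsOpen _ (hullKernel Ω₀) V → V.Nonempty →
      (V ∩ Set.range ι).Nonempty) := by
  have mem_iota : ∀ (I : Idl Ω₀) (x : X), ι x ∈ ptOpen I ↔ x ∈ ⋃₀ I.1 := by
    intro I x
    change I ∈ (ι x).1 ↔ _
    rw [hι x]
    rfl
  have empty_mem : ∀ I : Idl Ω₀, (∅ : Set X) ∈ I.1 := by
    intro I
    obtain ⟨U, hU⟩ := I.2.nonempty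
    exact I.2.lower U hU ∅ hΩ.empty_mem (Set.empty_subset U)
  have basis : ∀ V : Set (Pt Ω₀), @IsOpen _ (hullKernel Ω₀) V → ∀ y ∈ V,
      ∃ I : Idl Ω₀, y ∈ ptOpen I ∧ ptOpen I ⊆ V := by
    intro V hV
    change TopologicalSpace.GenerateOpen _ V at hV
    induction hV with
    | basic s hs =>
      intro y hy
      obtain ⟨I, rfl⟩ := hs
      exact ⟨I, hy, subset_rfl⟩
    | univ =>
      intro y _
      obtain ⟨I, hI⟩ := y.2.nonempty
      exact ⟨I, hI, Set.subset_univ _⟩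
    | inter s t _ _ ihs iht =>
      intro y hy
      obtain ⟨I, hI, hIs⟩ := ihs y hy.1
      obtain ⟨J, hJ, hJt⟩ := iht y hy.2
      have hK : IsIdealOn Ω₀ (I.1 ∩ J.1) :=
        { subset := fun U hU => I.2.subset hU.1
          nonempty := ⟨∅, empty_mem I, empty_mem J⟩
          lower := fun U hU V hV hVU => ⟨I.2.lower U hU.1 V hV hVU, J.2.lower U hU.2 V hV hVU⟩
          directed := by
            intro U hU V hV
            have hUV := hΩ.union_mem U (I.2.subset hU.1) V (I.2.subset hV.1)
            obtain ⟨W, hW, h1, h2⟩ := I.2.directed U hU.1 V hV.1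
            obtain ⟨W', hW', h1', h2'⟩ := J.2.directed U hU.2 V hV.2
            exact ⟨U ∪ V, ⟨I.2.lower W hW _ hUV (Set.union_subset h1 h2),
              J.2.lower W' hW' _ hUV (Set.union_subset h1' h2')⟩,
              Set.subset_union_left, Set.subset_union_right⟩ }
      have hKI : (⟨I.1 ∩ J.1, hK⟩ : Idl Ω₀) ≤ I := fun U hU => hU.1
      have hKJ : (⟨I.1 ∩ J.1, hK⟩ : Idl Ω₀) ≤ J := fun U hU => hU.2
      refine ⟨⟨I.1 ∩ J.1, hK⟩, y.2.inf_mem I hI J hJ _ ⟨?_, ?_⟩, ?_⟩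
      · rintro L (rfl | rfl)
        · exact hKI
        · exact hKJ
      · intro L hL U hU
        exact ⟨hL (Set.mem_insert _ _) hU, hL (Set.mem_insert_of_mem _ rfl) hU⟩
      · intro z hz
        exact ⟨hIs (z.2.upper _ hz I hKI), hJt (z.2.upper _ hz J hKJ)⟩
    | sUnion S _ ih =>
      intro y hy
      obtain ⟨s, hs, hys⟩ := hy
      obtain ⟨I, hI, hIs⟩ := ih s hs y hys
      exact ⟨I, hI, hIs.trans (Set.subset_sUnion_of_mem hs)⟩
  refine ⟨?_, ?_⟩
  · intro I
    ext y
    constructor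
    · rintro ⟨hy, x, rfl⟩
      exact ⟨x, (mem_iota I x).1 hy, rfl⟩
    · rintro ⟨x, hx, rfl⟩
      exact ⟨(mem_iota I x).2 hx, x, rfl⟩
  · rintro V hV ⟨y, hy⟩
    obtain ⟨I, hI, hIV⟩ := basis V hV y hy
    by_cases h : (⋃₀ I.1).Nonempty
    · obtain ⟨x, hx⟩ := h
      exact ⟨ι x, hIV ((mem_iota I x).2 hx), x, rfl⟩
    · exfalso
      have hlub : IsLUB (∅ : Set (Idl Ω₀)) I := by
        refine ⟨fun L hL => hL.elim, fun L _ U hU => ?_⟩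
        have hUe : U = ∅ := by
          rw [Set.eq_empty_iff_forall_notMem]
          exact fun x hx => h ⟨x, U, hU, hx⟩
        rw [hUe]
        exact empty_mem L
      obtain ⟨J, hJ, _⟩ := y.2.prime ∅ I hlub hI
      exact hJ
end

section
/- Let X be a T0 topological space and Ω₀ a viable base of X (a ring of open sets that is also a base for the topology). Then the map ι : X → X̂_{Ω₀}, ι(x) = { I ∈ Idl(Ω₀) : x ∈ ⋃I }, is a dense topological embedding (injective, continuous, and relatively open with dense image) of X into X̂_{Ω₀}, and X̂_{Ω₀} is core-compact; in fact the lattice of hull-kernel open sets of X̂_{Ω₀}, ordered by inclusion, is an algebraic (hence continuous) lattice. Thus X̂_{Ω₀} is a core-compactification of X. -/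
open Set TopologicalSpace

namespace SpecCC

theorem wb_sup {L : Type*} [CompleteLattice L] {a b x : L} (ha : WayBelow a x)
    (hb : WayBelow b x) : WayBelow (a ⊔ b) x := by
  intro A hne hd s hs hx
  obtain ⟨c, hc, hac⟩ := ha A hne hd s hs hx
  obtain ⟨d, hdA, hbd⟩ := hb A hne hd s hs hx
  obtain ⟨e, he, hce, hde⟩ := hd c hc d hdA
  exact ⟨e, he, sup_le (hac.trans hce) (hbd.trans hde)⟩

theorem wb_mono {L : Type*} [CompleteLattice L] {a x y : L} (ha : WayBelow a x)
    (h : x ≤ y) : WayBelow a y :=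
  fun A hne hd s hs hx => ha A hne hd s hs (h.trans hx)

theorem wb_bot {L : Type*} [CompleteLattice L] (x : L) : WayBelow ⊥ x := by
  intro A hne hd s hs hx
  obtain ⟨c, hc⟩ := hne
  exact ⟨c, hc, bot_le⟩

theorem wb_le {L : Type*} [CompleteLattice L] {a x : L} (ha : WayBelow a x) : a ≤ x := by
  obtain ⟨d, hd, h⟩ := ha {x} ⟨x, rfl⟩ (by
    intro p hp q hq
    rw [mem_singleton_iff] at hp hq
    subst hp
    subst hq
    exact ⟨_, rfl, le_rfl, le_rfl⟩) x isLUB_singleton le_rfl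
  rw [mem_singleton_iff] at hd
  exact hd ▸ h

theorem alg_of {L : Type*} [CompleteLattice L]
    (h : ∀ x y : L, (∀ a, WayBelow a a → a ≤ x → a ≤ y) → x ≤ y) : IsAlgebraicLattice L := by
  intro x
  refine ⟨⟨⊥, wb_bot _, bot_le⟩, ?_, fun a ha => ha.2, fun y hy => h x y fun a h1 h2 => hy ⟨h1, h2⟩⟩
  rintro a ⟨ha, hax⟩ b ⟨hb, hbx⟩
  exact ⟨a ⊔ b, ⟨wb_sup (wb_mono ha le_sup_left) (wb_mono hb le_sup_right), sup_le hax hbx⟩,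
    le_sup_left, le_sup_right⟩

theorem cont_of_alg {L : Type*} [CompleteLattice L] (h : IsAlgebraicLattice L) :
    IsContinuousLattice L := by
  intro x
  refine ⟨⟨⊥, wb_bot _⟩, ?_, fun a ha => wb_le ha, fun y hy => (h x).2.2.2 ?_⟩
  · intro a ha b hb
    exact ⟨a ⊔ b, wb_sup ha hb, le_sup_left, le_sup_right⟩
  · rintro a ⟨ha, hax⟩
    exact hy (wb_mono ha hax)

variable {X : Type*} [TopologicalSpace X] {Ω₀ : Set (Set X)}

theorem ideal_union (hΩ : IsOpenRing X Ω₀) {I : Set (Set X)} (hI : IsIdealOn Ω₀ I) {U V : Set X}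
    (hU : U ∈ I) (hV : V ∈ I) : U ∪ V ∈ I := by
  obtain ⟨W, hW, h1, h2⟩ := hI.directed U hU V hV
  exact hI.lower W hW _ (hΩ.union_mem U (hI.subset hU) V (hI.subset hV)) (union_subset h1 h2)

theorem principal_le (hΩ : IsOpenRing X Ω₀) (I : Idl Ω₀) {U : Set X} (hU : U ∈ I.1) :
    principalIdl hΩ U ≤ I := fun V hV => I.2.lower U hU V hV.1 hV.2

/-- membership of an ideal in a point is witnessed by a principal ideal -/
theorem exists_principal (hΩ : IsOpenRing X Ω₀) (y : Pt Ω₀) (I : Idl Ω₀) (h : I ∈ y.1) :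
    ∃ U ∈ I.1, principalIdl hΩ U ∈ y.1 := by
  obtain ⟨J, ⟨U, hU, rfl⟩, hJ⟩ := y.2.prime ((fun U => principalIdl hΩ U) '' I.1) I (by
    refine ⟨?_, ?_⟩
    · rintro _ ⟨U, hU, rfl⟩
      exact principal_le hΩ I hU
    · intro K hK U hU
      exact hK ⟨U, hU, rfl⟩ ⟨I.2.subset hU, subset_rfl⟩) h
  exact ⟨U, hU, hJ⟩

theorem principal_inter (hΩ : IsOpenRing X Ω₀) (y : Pt Ω₀) {U V : Set X}
    (hU : principalIdl hΩ U ∈ y.1) (hV : principalIdl hΩ V ∈ y.1) :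
    principalIdl hΩ (U ∩ V) ∈ y.1 := by
  refine y.2.inf_mem _ hU _ hV _ ⟨?_, ?_⟩
  · rintro J (rfl | rfl)
    · exact fun W hW => ⟨hW.1, hW.2.trans inter_subset_left⟩
    · exact fun W hW => ⟨hW.1, hW.2.trans inter_subset_right⟩
  · intro K hK W hW
    have h1 := hK (mem_insert _ _) hW
    have h2 := hK (mem_insert_of_mem _ rfl) hW
    exact ⟨h1.1, subset_inter h1.2 h2.2⟩

theorem principal_union (hΩ : IsOpenRing X Ω₀) (y : Pt Ω₀) {U V : Set X} (hU' : U ∈ Ω₀)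
    (hV' : V ∈ Ω₀) (h : principalIdl hΩ (U ∪ V) ∈ y.1) :
    principalIdl hΩ U ∈ y.1 ∨ principalIdl hΩ V ∈ y.1 := by
  obtain ⟨J, hJ, hJy⟩ := y.2.prime {principalIdl hΩ U, principalIdl hΩ V} _ (by
    refine ⟨?_, ?_⟩
    · rintro J (rfl | rfl)
      · exact fun W hW => ⟨hW.1, hW.2.trans subset_union_left⟩
      · exact fun W hW => ⟨hW.1, hW.2.trans subset_union_right⟩
    · intro K hK W hW
      have h1 := hK (mem_insert _ _) (show U ∈ _ from ⟨hU', subset_rfl⟩)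
      have h2 := hK (mem_insert_of_mem _ rfl) (show V ∈ _ from ⟨hV', subset_rfl⟩)
      exact K.2.lower _ (ideal_union hΩ K.2 h1 h2) W hW.1 hW.2) h
  rcases hJ with rfl | rfl
  · exact Or.inl hJy
  · exact Or.inr hJy

theorem not_empty_mem (hΩ : IsOpenRing X Ω₀) (y : Pt Ω₀) : principalIdl hΩ ∅ ∉ y.1 := by
  intro h
  obtain ⟨J, hJ, _⟩ := y.2.prime ∅ _ (by
    refine ⟨by simp, ?_⟩
    intro K _ W hW
    obtain ⟨Z, hZ⟩ := K.2.nonempty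
    exact K.2.lower Z hZ W hW.1 (hW.2.trans (empty_subset _))) h
  exact hJ

theorem isOpen_pt (I : Idl Ω₀) : @IsOpen _ (hullKernel Ω₀) (ptOpen I) :=
  isOpen_generateFrom_of_mem ⟨I, rfl⟩

/-- principal opens form a base -/
theorem base (hΩ : IsOpenRing X Ω₀) (O : Set (Pt Ω₀)) (hO : @IsOpen _ (hullKernel Ω₀) O)
    (y : Pt Ω₀) (hy : y ∈ O) : ∃ V ∈ Ω₀, y ∈ ptOpen (principalIdl hΩ V) ∧
      ptOpen (principalIdl hΩ V) ⊆ O := by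
  have hO' : GenerateOpen {V : Set (Pt Ω₀) | ∃ I : Idl Ω₀, V = ptOpen I} O := hO
  induction hO' with
  | basic s hs =>
    obtain ⟨I, rfl⟩ := hs
    obtain ⟨U, hU, h⟩ := exists_principal hΩ y I hy
    exact ⟨U, I.2.subset hU, h, fun z hz => z.2.upper _ hz _ (principal_le hΩ I hU)⟩
  | univ =>
    obtain ⟨I, hI⟩ := y.2.nonempty
    obtain ⟨U, hU, h⟩ := exists_principal hΩ y I hI
    exact ⟨U, I.2.subset hU, h, subset_univ _⟩
  | inter s t hs ht ihs iht =>
    obtain ⟨U, hU, h1, h2⟩ := ihs hs hy.1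
    obtain ⟨V, hV, h3, h4⟩ := iht ht hy.2
    refine ⟨U ∩ V, hΩ.inter_mem U hU V hV, principal_inter hΩ y h1 h3, fun z hz => ⟨h2 ?_, h4 ?_⟩⟩
    · exact z.2.upper _ hz _ fun W hW => ⟨hW.1, hW.2.trans inter_subset_left⟩
    · exact z.2.upper _ hz _ fun W hW => ⟨hW.1, hW.2.trans inter_subset_right⟩
  | sUnion S hS ih =>
    obtain ⟨s, hs, hys⟩ := hy
    obtain ⟨U, hU, h1, h2⟩ := ih s hs (hS s hs) hys
    exact ⟨U, hU, h1, h2.trans (subset_sUnion_of_mem hs)⟩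

/-- separation: prime ideal theorem -/
theorem exists_pt (hΩ : IsOpenRing X Ω₀) (J : Idl Ω₀) (U : Set X) (hU : U ∈ Ω₀) (hUJ : U ∉ J.1) :
    ∃ y : Pt Ω₀, principalIdl hΩ U ∈ y.1 ∧ J ∉ y.1 := by
  obtain ⟨P, hJP, hP⟩ := zorn_subset_nonempty {P | IsIdealOn Ω₀ P ∧ U ∉ P} (by
    intro c hc hch hne
    refine ⟨⋃₀ c, ⟨⟨?_, ?_, ?_, ?_⟩, ?_⟩, fun s hs => subset_sUnion_of_mem hs⟩
    · exact sUnion_subset fun s hs => (hc hs).1.subset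
    · obtain ⟨s, hs⟩ := hne
      obtain ⟨Z, hZ⟩ := (hc hs).1.nonempty
      exact ⟨Z, s, hs, hZ⟩
    · rintro A ⟨s, hs, hA⟩ B hB hBA
      exact ⟨s, hs, (hc hs).1.lower A hA B hB hBA⟩
    · rintro A ⟨s, hs, hA⟩ B ⟨t, ht, hB⟩
      obtain ⟨r, hr, h1, h2⟩ := hch.directedOn s hs t ht
      obtain ⟨W, hW, h3⟩ := (hc hr).1.directed A (h1 hA) B (h2 hB)
      exact ⟨W, ⟨r, hr, hW⟩, h3⟩
    · rintro ⟨s, hs, hA⟩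
      exact (hc hs).2 hA) J.1 ⟨J.2, hUJ⟩
  obtain ⟨⟨hPI, hUP⟩, hmax⟩ := hP
  have key : ∀ V ∈ Ω₀, V ∉ P → ∃ p ∈ P, U ⊆ p ∪ V := by
    intro V hV hVP
    by_contra hcon
    push Not at hcon
    obtain ⟨Z, hZ⟩ := hPI.nonempty
    have hle := @hmax {W | W ∈ Ω₀ ∧ ∃ p ∈ P, W ⊆ p ∪ V} ⟨⟨fun W hW => hW.1,
      ⟨V, hV, Z, hZ, subset_union_right⟩, fun A hA B hB hBA => ⟨hB, ?_⟩, ?_⟩, ?_⟩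
      (fun W hW => ⟨hPI.subset hW, W, hW, subset_union_left⟩)
    · exact hVP (hle ⟨hV, Z, hZ, subset_union_right⟩)
    · obtain ⟨p, hp, h⟩ := hA.2
      exact ⟨p, hp, hBA.trans h⟩
    · rintro A ⟨hA, p, hp, hAp⟩ B ⟨hB, q, hq, hBq⟩
      refine ⟨A ∪ B, ⟨hΩ.union_mem A hA B hB, p ∪ q, ideal_union hΩ hPI hp hq, ?_⟩,
        subset_union_left, subset_union_right⟩
      refine union_subset (hAp.trans ?_) (hBq.trans ?_)
      · exact union_subset_union_left _ subset_union_left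
      · exact union_subset_union_left _ subset_union_right
    · rintro ⟨_, p, hp, h⟩
      exact hcon p hp h
  have prime : ∀ V ∈ Ω₀, ∀ W ∈ Ω₀, V ∉ P → W ∉ P → V ∩ W ∉ P := by
    intro V hV W hW hVP hWP hVW
    obtain ⟨p, hp, h1⟩ := key V hV hVP
    obtain ⟨q, hq, h2⟩ := key W hW hWP
    refine hUP (hPI.lower _ (ideal_union hΩ hPI (ideal_union hΩ hPI hp hq) hVW) U hU ?_)
    intro x hx
    have h3 := h1 hx
    have h4 := h2 hx
    simp only [mem_union, mem_inter_iff] at h3 h4 ⊢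
    tauto
  refine ⟨⟨{I | ¬ I.1 ⊆ P}, ⟨?_, ?_, ?_, ?_⟩⟩, ?_, ?_⟩
  · exact ⟨principalIdl hΩ U, fun h => hUP (h ⟨hU, subset_rfl⟩)⟩
  · intro I hI K hIK hK
    exact hI (subset_trans hIK hK)
  · intro I hI K hK M hM hMP
    obtain ⟨V, hV, hVP⟩ := not_subset.1 hI
    obtain ⟨W, hW, hWP⟩ := not_subset.1 hK
    have hV' := I.2.subset hV
    have hW' := K.2.subset hW
    have hVW := hΩ.inter_mem V hV' W hW'
    have hlow : principalIdl hΩ (V ∩ W) ∈ lowerBounds {I, K} := by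
      intro N hN
      rcases hN with h | h
      · rw [h]
        exact principal_le hΩ _ (I.2.lower V hV _ hVW inter_subset_left)
      · rw [mem_singleton_iff.1 h]
        exact principal_le hΩ _ (K.2.lower W hW _ hVW inter_subset_right)
    exact prime V hV' W hW' hVP hWP (hMP (hM.2 hlow ⟨hVW, subset_rfl⟩))
  · intro A I hA hI
    by_contra hcon
    push Not at hcon
    suffices hup : (⟨P, hPI⟩ : Idl Ω₀) ∈ upperBounds A from hI (hA.2 hup)
    intro K hK
    by_contra h
    exact hcon K hK h
  · exact fun h => hUP (h ⟨hU, subset_rfl⟩)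
  · exact fun h => h hJP

theorem compact_principal (hΩ : IsOpenRing X Ω₀) (U : Set X) (hU : U ∈ Ω₀) :
    letI : TopologicalSpace (Pt Ω₀) := hullKernel Ω₀
    WayBelow (⟨ptOpen (principalIdl hΩ U), isOpen_pt _⟩ : Opens (Pt Ω₀))
      ⟨ptOpen (principalIdl hΩ U), isOpen_pt _⟩ := by
  letI : TopologicalSpace (Pt Ω₀) := hullKernel Ω₀
  intro A hne hd a ha hUa
  by_contra hcon
  let J : Idl Ω₀ := ⟨{V | V ∈ Ω₀ ∧ ∃ d ∈ A, ptOpen (principalIdl hΩ V) ⊆ d.1}, by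
    refine ⟨fun V hV => hV.1, ?_, ?_, ?_⟩
    · obtain ⟨d, hd⟩ := hne
      exact ⟨∅, hΩ.empty_mem, d, hd, fun y hy => (not_empty_mem hΩ y hy).elim⟩
    · rintro V ⟨hV, d, hd, h⟩ W hW hWV
      exact ⟨hW, d, hd, fun y hy => h (y.2.upper _ hy _ fun Z hZ => ⟨hZ.1, hZ.2.trans hWV⟩)⟩
    · rintro V ⟨hV, d, hdA, h⟩ W ⟨hW, e, he, h'⟩
      obtain ⟨f, hf, hdf, hef⟩ := hd d hdA e he
      refine ⟨V ∪ W, ⟨hΩ.union_mem V hV W hW, f, hf, fun y hy => ?_⟩,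
        subset_union_left, subset_union_right⟩
      rcases principal_union hΩ y hV hW hy with h1 | h1
      · exact hdf (h h1)
      · exact hef (h' h1)⟩
  have hUJ : U ∉ J.1 := by
    rintro ⟨_, d, hd, h⟩
    exact hcon ⟨d, hd, h⟩
  obtain ⟨y, hy, hyJ⟩ := exists_pt hΩ J U hU hUJ
  have hya : y ∈ a := hUa hy
  rw [← ha.sSup_eq, Opens.mem_sSup] at hya
  obtain ⟨d, hdA, hyd⟩ := hya
  obtain ⟨V, hV, h1, h2⟩ := base hΩ d.1 d.2 y hyd
  exact hyJ (y.2.upper _ h1 _ (principal_le hΩ J ⟨hV, d, hdA, h2⟩))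

end SpecCC

/-- For a T0 space `X` and a viable base `Ω₀`, the map `ι : X → X̂_{Ω₀}` is
a dense topological embedding (injective, continuous, relatively open, with dense image),
and the lattice of hull-kernel open sets of `X̂_{Ω₀}` is algebraic, hence continuous; thus
`X̂_{Ω₀}` is a core-compactification of `X`. -/
theorem spectral_coreCompactification {X : Type*} [TopologicalSpace X] [T0Space X]
    {Ω₀ : Set (Set X)} (hΩ : IsOpenRing X Ω₀)
    (hbase : ∀ U : Set X, IsOpen U → ∀ x ∈ U, ∃ W ∈ Ω₀, x ∈ W ∧ W ⊆ U)
    (ι : X → Pt Ω₀)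
    (hι : ∀ x : X, (ι x).1 = {I : Idl Ω₀ | x ∈ ⋃₀ I.1}) :
    Function.Injective ι ∧
    @Continuous X (Pt Ω₀) _ (hullKernel Ω₀) ι ∧
    (∀ U : Set X, IsOpen U → ∃ V : Set (Pt Ω₀), @IsOpen _ (hullKernel Ω₀) V ∧ U = ι ⁻¹' V) ∧
    @Dense (Pt Ω₀) (hullKernel Ω₀) (Set.range ι) ∧
    (letI : TopologicalSpace (Pt Ω₀) := hullKernel Ω₀
     IsAlgebraicLattice (TopologicalSpace.Opens (Pt Ω₀)) ∧
     IsContinuousLattice (TopologicalSpace.Opens (Pt Ω₀))) := by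
  have hmem : ∀ (x : X) (I : Idl Ω₀), I ∈ (ι x).1 ↔ x ∈ ⋃₀ I.1 := by
    intro x I
    rw [hι x]
    rfl
  have hpre : ∀ I : Idl Ω₀, ι ⁻¹' (ptOpen I) = ⋃₀ I.1 := by
    intro I
    ext x
    exact hmem x I
  have hsU : ∀ U : Set X, IsOpen U → ⋃₀ (principalIdl hΩ U).1 = U := by
    intro U hU
    ext x
    constructor
    · rintro ⟨W, hW, hx⟩
      exact hW.2 hx
    · intro hx
      obtain ⟨W, hW, hxW, hWU⟩ := hbase U hU x hx
      exact ⟨W, ⟨hW, hWU⟩, hxW⟩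
  refine ⟨?_, ?_, ?_, ?_, ?_⟩
  · intro x y hxy
    refine (inseparable_iff_forall_isOpen.2 fun U hU => ?_).eq
    rw [← hsU U hU, ← hmem, ← hmem, hxy]
  · refine continuous_generateFrom_iff.2 ?_
    rintro _ ⟨I, rfl⟩
    rw [hpre]
    exact isOpen_sUnion fun W hW => hΩ.isOpen W (I.2.subset hW)
  · intro U hU
    exact ⟨ptOpen (principalIdl hΩ U), SpecCC.isOpen_pt _, by rw [hpre, hsU U hU]⟩
  · letI : TopologicalSpace (Pt Ω₀) := hullKernel Ω₀
    rw [dense_iff_inter_open]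
    rintro O hO ⟨y, hy⟩
    obtain ⟨V, hV, h1, h2⟩ := SpecCC.base hΩ O hO y hy
    rcases V.eq_empty_or_nonempty with rfl | ⟨x, hx⟩
    · exact (SpecCC.not_empty_mem hΩ y h1).elim
    · exact ⟨ι x, h2 ((hmem x _).2 ⟨V, ⟨hV, subset_rfl⟩, hx⟩), x, rfl⟩
  · letI : TopologicalSpace (Pt Ω₀) := hullKernel Ω₀
    have halg : IsAlgebraicLattice (TopologicalSpace.Opens (Pt Ω₀)) := by
      refine SpecCC.alg_of fun O O' h y hy => ?_
      obtain ⟨V, hV, h1, h2⟩ := SpecCC.base hΩ O.1 O.2 y hy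
      exact h _ (SpecCC.compact_principal hΩ V hV) h2 h1
    exact ⟨halg, SpecCC.cont_of_alg halg⟩
end
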